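/- arXiv:math/0409284 — 6 statements merged into one kernel-verified Lean document; each statement's English description precedes it below -/
import Mathlib

section
/- Let k ≥ 2 and let g, h be nontrivial elements of F = FreeGroup (Fin k). Then the following are equivalent: (i) for every automorphism φ of F one has ‖φ g‖ = ‖φ h‖ (i.e., g and h have equal cyclically reduced length with respect to every free basis of F); (ii) for every automorphism φ of F, every generator a : Fin k, and all cyclically reduced representatives ℓ_g of φ g and ℓ_h of φ h, one has n(ℓ_g; a) = n(ℓ_h; a). -/
/-- The cyclically reduced length of an element of a free group: the minimal
reduced word length among its conjugates. -/
noncomputable def cyclLen {α : Type*} [DecidableEq α] (g : FreeGroup α) : ℕ :=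
  sInf {n : ℕ | ∃ x : FreeGroup α, FreeGroup.norm (x * g * x⁻¹) = n}

/-- `ℓ` is a cyclically reduced representative of `g`. -/
def IsCyclRep {k : ℕ} (g : FreeGroup (Fin k)) (ℓ : List (Fin k × Bool)) : Prop :=
  FreeGroup.reduce ℓ = ℓ ∧ IsConj (FreeGroup.mk ℓ) g ∧ ℓ.length = cyclLen g

/-- `n(ℓ; a)`: the total number of occurrences of the letters `a` and `a⁻¹` in `ℓ`. -/
def nLetter {k : ℕ} (ℓ : List (Fin k × Bool)) (a : Fin k) : ℕ :=
  (ℓ.filter (fun p => decide (p.1 = a))).length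

open FreeGroup

theorem mk_cons {α : Type*} (x : α × Bool) (L : List (α × Bool)) :
    mk (x :: L) = mk [x] * mk L := by
  rw [mul_mk]; rfl

section CyclicLength

variable {α : Type*} [DecidableEq α]

theorem norm_pow_succ (g : FreeGroup α) (n : ℕ) :
    (g ^ (n + 1)).norm =
      g.norm + n * (reduceCyclically g.toWord).length := by
  have key (m : ℕ) : (g ^ (m + 1)).norm = (reduceCyclically.conjugator g.toWord).length +
      ((m + 1) * (reduceCyclically g.toWord).length +
        (reduceCyclically.conjugator g.toWord).length) := by
    rw [FreeGroup.norm, toWord_pow, reduceCyclically.reduce_flatten_replicate_succ isReduced_toWord]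
    simp
  have h1 := key 0
  rw [zero_add, pow_one] at h1
  rw [key n, h1]
  ring

theorem length_reduceCyclically_toWord_conj_le (g x : FreeGroup α) :
    (reduceCyclically (x * g * x⁻¹).toWord).length ≤ (reduceCyclically g.toWord).length := by
  by_contra! hlt
  set D := (reduceCyclically g.toWord).length
  have h1 := norm_pow_succ (x * g * x⁻¹) (g.norm + 2 * x.norm + 1)
  rw [conj_pow] at h1
  have h2 := norm_pow_succ g (g.norm + 2 * x.norm + 1)
  have h3 := norm_mul_le (x * g ^ (g.norm + 2 * x.norm + 1 + 1)) x⁻¹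
  have h4 := norm_mul_le x (g ^ (g.norm + 2 * x.norm + 1 + 1))
  rw [norm_inv_eq] at h3
  have h5 := Nat.mul_le_mul_left (g.norm + 2 * x.norm + 1) (Nat.succ_le_of_lt hlt)
  rw [Nat.mul_succ] at h5
  lia

theorem length_reduceCyclically_toWord_conj (g x : FreeGroup α) :
    (reduceCyclically (x * g * x⁻¹).toWord).length = (reduceCyclically g.toWord).length := by
  refine le_antisymm (length_reduceCyclically_toWord_conj_le g x) ?_
  have := length_reduceCyclically_toWord_conj_le (x * g * x⁻¹) x⁻¹
  rwa [show x⁻¹ * (x * g * x⁻¹) * x⁻¹⁻¹ = g by group] at this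

theorem length_reduceCyclically_toWord_le_norm (g : FreeGroup α) :
    (reduceCyclically g.toWord).length ≤ g.norm := by
  conv_rhs => rw [FreeGroup.norm, ← reduceCyclically.conj_conjugator_reduceCyclically g.toWord]
  simp only [List.length_append]
  lia

theorem cyclLen_eq_length_reduceCyclically (g : FreeGroup α) :
    cyclLen g = (reduceCyclically g.toWord).length := by
  apply le_antisymm
  · apply Nat.sInf_le
    refine ⟨(mk (reduceCyclically.conjugator g.toWord))⁻¹, ?_⟩
    have h : (mk (reduceCyclically.conjugator g.toWord))⁻¹ * g *
        (mk (reduceCyclically.conjugator g.toWord))⁻¹⁻¹ = mk (reduceCyclically g.toWord) := by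
      conv_lhs => enter [1, 2]; rw [← mk_toWord (x := g),
        ← reduceCyclically.conj_conjugator_reduceCyclically g.toWord, ← mul_mk, ← mul_mk, ← inv_mk]
      group
    rw [h, FreeGroup.norm, toWord_mk,
      (reduceCyclically.isCyclicallyReduced isReduced_toWord).isReduced.reduce_eq]
  · obtain ⟨x, hx⟩ := Nat.sInf_mem
      (⟨_, 1, rfl⟩ : {n : ℕ | ∃ x : FreeGroup α, (x * g * x⁻¹).norm = n}.Nonempty)
    rw [cyclLen, ← hx, ← length_reduceCyclically_toWord_conj g x]
    exact length_reduceCyclically_toWord_le_norm _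

theorem norm_mul_self (g : FreeGroup α) : (g * g).norm = g.norm + cyclLen g := by
  rw [← sq, norm_pow_succ g 1, cyclLen_eq_length_reduceCyclically, one_mul]

theorem cyclLen_eq_of_isConj {g h : FreeGroup α} (hc : IsConj g h) : cyclLen g = cyclLen h := by
  obtain ⟨x, rfl⟩ := isConj_iff.1 hc
  simp only [cyclLen_eq_length_reduceCyclically, length_reduceCyclically_toWord_conj]

end CyclicLength

section Transvection

variable {α : Type*} [DecidableEq α]

/-- The automorphism of the free group sending `b` to `b * a⁻¹` and fixing the other generators. -/
def transvection {a b : α} (hab : a ≠ b) : FreeGroup α ≃* FreeGroup α :=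
  MonoidHom.toMulEquiv
    (lift fun x => if x = b then of b * (of a)⁻¹ else of x)
    (lift fun x => if x = b then of b * of a else of x)
    (by ext x; by_cases hx : x = b <;> simp [hx, hab])
    (by ext x; by_cases hx : x = b <;> simp [hx, hab])

/-- The automorphism of the free group exchanging `a` with `b⁻¹`, fixing the other generators. -/
def invSwap (a b : α) : FreeGroup α ≃* FreeGroup α :=
  MonoidHom.toMulEquiv
    (lift fun x => if x = a then (of b)⁻¹ else if x = b then (of a)⁻¹ else of x)
    (lift fun x => if x = a then (of b)⁻¹ else if x = b then (of a)⁻¹ else of x)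
    (by ext x; by_cases hx : x = a <;> by_cases hy : x = b <;> by_cases h : b = a <;> simp_all)
    (by ext x; by_cases hx : x = a <;> by_cases hy : x = b <;> by_cases h : b = a <;> simp_all)

/-- The action of `invSwap a b` on letters. -/
def invSwapLetter (a b : α) (x : α × Bool) : α × Bool :=
  if x.1 = a then (b, !x.2) else if x.1 = b then (a, !x.2) else x

/-- The number of adjacent pairs `b a` and `a⁻¹ b⁻¹` in a word. -/
def pairCount (a b : α) : List (α × Bool) → ℕ
  | [] => 0
  | [_] => 0
  | x :: y :: L =>
    (if (x = (b, true) ∧ y = (a, true)) ∨ (x = (a, false) ∧ y = (b, false)) then 1 else 0) +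
      pairCount a b (y :: L)

theorem invSwap_mk (a b : α) (L : List (α × Bool)) :
    invSwap a b (mk L) = mk (L.map (invSwapLetter a b)) := by
  induction L with
  | nil => exact _root_.map_one _
  | cons x L ih =>
    rw [mk_cons, _root_.map_mul, ih, List.map_cons, mk_cons (invSwapLetter a b x)]
    congr 1
    obtain ⟨x, _ | _⟩ := x <;> by_cases hx : x = a <;> by_cases hy : x = b <;>
      simp [invSwap, invSwapLetter, lift_mk, hx, hy, of, inv_mk, invRev] <;>
      split_ifs <;> simp_all [inv_mk, invRev]

theorem isReduced_map_invSwapLetter (a b : α) {L : List (α × Bool)} (hL : IsReduced L) :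
    IsReduced (L.map (invSwapLetter a b)) := by
  rw [FreeGroup.IsReduced, List.isChain_map]
  refine hL.imp fun x y h => ?_
  grind [invSwapLetter]

theorem pairCount_map_invSwapLetter {a b : α} (hab : a ≠ b) (L : List (α × Bool)) :
    pairCount a b (L.map (invSwapLetter a b)) = pairCount a b L := by
  fun_induction pairCount a b L with
  | case1 => rfl
  | case2 => rfl
  | case3 x y L ih =>
    rw [← ih]
    obtain ⟨x, _ | _⟩ := x <;> obtain ⟨y, _ | _⟩ := y <;>
    · simp only [List.map_cons, pairCount, invSwapLetter]
      grind

theorem countP_map_invSwapLetter (a b : α) (L : List (α × Bool)) :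
    (L.map (invSwapLetter a b)).countP (fun p => decide (p.1 = b)) =
      L.countP (fun p => decide (p.1 = a)) := by
  rw [List.countP_map]
  congr 1
  ext x
  grind [invSwapLetter]

theorem transvection_mk_singleton {a b : α} (hab : a ≠ b) (x : α × Bool) :
    transvection hab (mk [x]) =
      if x = (b, true) then mk [(b, true), (a, false)]
      else if x = (b, false) then mk [(a, true), (b, false)] else mk [x] := by
  obtain ⟨x, _ | _⟩ := x <;> by_cases hx : x = b <;>
    simp [transvection, lift_mk, of, inv_mk, invRev, hx]

theorem exists_isReduced_transvection {a b : α} (hab : a ≠ b) (n : ℕ) :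
    ∀ L : List (α × Bool), L.length ≤ n → IsReduced L →
    ∃ W : List (α × Bool), IsReduced W ∧ mk W = transvection hab (mk L) ∧
      W.length + 2 * pairCount a b L = L.length + L.countP (fun p => decide (p.1 = b)) ∧
      ∀ y ∈ W.head?,
        (y = (b, true) → L.head? = some (b, true)) ∧
        (y = (a, true) → L.head? = some (a, true) ∨ L.head? = some (b, false)) ∧
        (y = (a, false) → L.head? = some (a, false)) ∧
        (y = (b, false) → ∃ L', L = (a, false) :: (b, false) :: L') ∧
        (y.1 ≠ a → y.1 ≠ b → L.head? = some y) := by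
  induction n with
  | zero =>
    intro L hn _
    obtain rfl : L = [] := List.length_eq_zero_iff.1 (by lia)
    exact ⟨[], .nil, (_root_.map_one (transvection hab)).symm, rfl, by simp⟩
  | succ n ih =>
    intro L hn hL
    obtain _ | ⟨x, L⟩ := L
    · exact ⟨[], .nil, (_root_.map_one (transvection hab)).symm, rfl, by simp⟩
    have hL' : FreeGroup.IsReduced L := hL.infix ⟨[x], [], by simp⟩
    by_cases hba : x = (b, true) ∧ L.head? = some (a, true)
    · obtain ⟨rfl, hy⟩ := hba
      obtain ⟨L, rfl⟩ : ∃ L', L = (a, true) :: L' := by cases L <;> simp_all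
      obtain ⟨W, hW, hmk, hlen, hhead⟩ := ih L (by simp at hn; lia)
        (hL'.infix ⟨[(a, true)], [], by simp⟩)
      clear ih
      refine ⟨(b, true) :: W, ?_, ?_, ?_, ?_⟩
      · rw [FreeGroup.IsReduced, List.isChain_cons] at hL' ⊢
        refine ⟨fun y hy => ?_, hW⟩
        have h1 := hhead y hy
        have h2 := hL'.1 (a, false)
        simp only [Option.mem_def] at h1 h2
        grind
      · rw [mk_cons, hmk, mk_cons _ (_ :: _), mk_cons _ L, _root_.map_mul, _root_.map_mul,
          ← mul_assoc, transvection_mk_singleton, transvection_mk_singleton, mul_left_inj]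
        simp [hab, mul_mk]
        exact (Quot.sound (Red.Step.not (L₁ := [(b, true)]) (b := false))).symm
      · simp only [pairCount, List.length_cons, List.countP_cons]
        cases L <;> grind [pairCount]
      · simp
    by_cases hab' : x = (a, false) ∧ L.head? = some (b, false)
    · obtain ⟨rfl, hy⟩ := hab'
      obtain ⟨L, rfl⟩ : ∃ L', L = (b, false) :: L' := by cases L <;> simp_all
      obtain ⟨W, hW, hmk, hlen, hhead⟩ := ih L (by simp at hn; lia)
        (hL'.infix ⟨[(b, false)], [], by simp⟩)
      clear ih
      refine ⟨(b, false) :: W, ?_, ?_, ?_, ?_⟩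
      · rw [FreeGroup.IsReduced, List.isChain_cons] at hL' ⊢
        refine ⟨fun y hy => ?_, hW⟩
        have h1 := hhead y hy
        have h2 := hL'.1 (b, true)
        simp only [Option.mem_def] at h1 h2
        grind
      · rw [mk_cons, hmk, mk_cons _ (_ :: _), mk_cons _ L, _root_.map_mul, _root_.map_mul,
          ← mul_assoc, transvection_mk_singleton, transvection_mk_singleton, mul_left_inj]
        simp [hab, mul_mk]
        exact (Quot.sound (Red.Step.cons_not (b := false))).symm
      · simp only [pairCount, List.length_cons, List.countP_cons]
        cases L <;> grind [pairCount]
      · simp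
    obtain ⟨W, hW, hmk, hlen, hhead⟩ := ih L (by simp at hn; lia) hL'
    clear ih
    have hpair : pairCount a b (x :: L) = pairCount a b L := by
      cases L <;> grind [pairCount]
    rw [FreeGroup.IsReduced, List.isChain_cons] at hL
    by_cases hbt : x = (b, true)
    · subst hbt
      refine ⟨(b, true) :: (a, false) :: W, ?_, ?_, ?_, ?_⟩
      · rw [FreeGroup.IsReduced, List.isChain_cons, List.isChain_cons]
        refine ⟨by grind, fun y hy => ?_, hW⟩
        have h1 := hhead y hy
        have h2 := hL.1 (a, true)
        have h3 := hL.1 (b, false)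
        simp only [Option.mem_def] at h1 h2 h3
        grind
      · rw [mk_cons, mk_cons _ W, hmk, mk_cons _ L, _root_.map_mul, ← mul_assoc,
          transvection_mk_singleton]
        simp [mul_mk]
      · grind
      · simp
    by_cases hbf : x = (b, false)
    · subst hbf
      refine ⟨(a, true) :: (b, false) :: W, ?_, ?_, ?_, ?_⟩
      · rw [FreeGroup.IsReduced, List.isChain_cons, List.isChain_cons]
        refine ⟨by grind, fun y hy => ?_, hW⟩
        have h1 := hhead y hy
        have h2 := hL.1 (a, true)
        have h3 := hL.1 (b, true)
        simp only [Option.mem_def] at h1 h2 h3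
        grind
      · rw [mk_cons, mk_cons _ W, hmk, mk_cons _ L, _root_.map_mul, ← mul_assoc,
          transvection_mk_singleton]
        simp [mul_mk]
      · grind
      · simp
        grind
    have hxb : x.1 ≠ b := by
      obtain ⟨x, _ | _⟩ := x <;> grind
    refine ⟨x :: W, ?_, ?_, ?_, ?_⟩
    · rw [FreeGroup.IsReduced, List.isChain_cons]
      refine ⟨fun y hy => ?_, hW⟩
      have h1 := hhead y hy
      have h2 := hL.1 y
      have h3 := hL.1 (b, false)
      simp only [Option.mem_def] at h1 h2 h3
      obtain ⟨x, _ | _⟩ := x <;> obtain ⟨y, _ | _⟩ := y <;> grind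
    · rw [mk_cons, hmk, mk_cons _ L, _root_.map_mul, transvection_mk_singleton,
        if_neg hbt, if_neg hbf]
    · grind
    · simp
      grind

theorem norm_transvection {a b : α} (hab : a ≠ b) {L : List (α × Bool)} (hL : IsReduced L) :
    (transvection hab (mk L)).norm + 2 * pairCount a b L =
      L.length + L.countP (fun p => decide (p.1 = b)) := by
  obtain ⟨W, hW, h, hlen, -⟩ := exists_isReduced_transvection hab L.length L le_rfl hL
  rw [← h, FreeGroup.norm, toWord_mk, hW.reduce_eq, hlen]

theorem norm_transvection_add_countP {a b : α} (hab : a ≠ b) {L : List (α × Bool)}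
    (hL : IsReduced L) :
    (transvection hab (mk L)).norm + L.countP (fun p => decide (p.1 = a)) =
      (transvection hab (invSwap a b (mk L))).norm + L.countP (fun p => decide (p.1 = b)) := by
  have h1 := norm_transvection hab hL
  have h2 := norm_transvection hab (isReduced_map_invSwapLetter a b hL)
  rw [← invSwap_mk, pairCount_map_invSwapLetter hab, countP_map_invSwapLetter,
    List.length_map] at h2
  lia

theorem cyclLen_transvection_add_countP {a b : α} (hab : a ≠ b) {L : List (α × Bool)}
    (hL : IsReduced L) (hlen : L.length = cyclLen (mk L)) :
    cyclLen (transvection hab (mk L)) + L.countP (fun p => decide (p.1 = a)) =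
      cyclLen (transvection hab (invSwap a b (mk L))) +
        L.countP (fun p => decide (p.1 = b)) := by
  have hLL : IsReduced (L ++ L) := by
    have h := norm_mul_self (mk L)
    rw [mul_mk, FreeGroup.norm, FreeGroup.norm, toWord_mk, toWord_mk, hL.reduce_eq, ← hlen,
      ← List.length_append] at h
    rw [isReduced_iff_reduce_eq]
    exact reduce.red.sublist.eq_of_length h
  have h1 := norm_transvection_add_countP hab hL
  have h2 := norm_transvection_add_countP hab hLL
  simp only [← mul_mk, _root_.map_mul, norm_mul_self, List.countP_append] at h2
  lia

end Transvection

section LetterCounts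

variable {k : ℕ}

theorem exists_isCyclRep (g : FreeGroup (Fin k)) : ∃ ℓ, IsCyclRep g ℓ := by
  obtain ⟨x, hx⟩ := Nat.sInf_mem
    (⟨_, 1, rfl⟩ : {n : ℕ | ∃ x : FreeGroup (Fin k), (x * g * x⁻¹).norm = n}.Nonempty)
  refine ⟨(x * g * x⁻¹).toWord, reduce_toWord _, ?_, hx⟩
  rw [mk_toWord]
  exact (isConj_iff.2 ⟨x, rfl⟩).symm

theorem nLetter_eq_countP (ℓ : List (Fin k × Bool)) (a : Fin k) :
    nLetter ℓ a = ℓ.countP (fun p => decide (p.1 = a)) :=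
  List.countP_eq_length_filter.symm

theorem sum_nLetter (ℓ : List (Fin k × Bool)) : ∑ a, nLetter ℓ a = ℓ.length := by
  simp only [nLetter_eq_countP]
  induction ℓ with
  | nil => simp
  | cons x ℓ ih => simp [List.countP_cons, Finset.sum_add_distrib, ih]

theorem IsCyclRep.cyclLen_transvection_add {g : FreeGroup (Fin k)} {ℓ : List (Fin k × Bool)}
    (hℓ : IsCyclRep g ℓ) {a b : Fin k} (hab : a ≠ b) :
    cyclLen (transvection hab g) + nLetter ℓ a =
      cyclLen (transvection hab (invSwap a b g)) + nLetter ℓ b := by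
  obtain ⟨hred, hconj, hlen⟩ := hℓ
  rw [← cyclLen_eq_of_isConj hconj] at hlen
  have h := cyclLen_transvection_add_countP hab (isReduced_iff_reduce_eq.2 hred) hlen
  have hconj' := (invSwap a b).toMonoidHom.map_isConj hconj
  have h1 := cyclLen_eq_of_isConj ((transvection hab).toMonoidHom.map_isConj hconj)
  have h2 := cyclLen_eq_of_isConj ((transvection hab).toMonoidHom.map_isConj hconj')
  simp only [MulEquiv.toMonoidHom_eq_coe, MonoidHom.coe_coe] at h1 h2
  rwa [nLetter_eq_countP, nLetter_eq_countP, ← h1, ← h2]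

end LetterCounts

theorem translation_equivalence_iff_letter_counts {k : ℕ} (hk : 2 ≤ k)
    (g h : FreeGroup (Fin k)) (hg : g ≠ 1) (hh : h ≠ 1) :
    (∀ φ : FreeGroup (Fin k) ≃* FreeGroup (Fin k), cyclLen (φ g) = cyclLen (φ h)) ↔
    (∀ φ : FreeGroup (Fin k) ≃* FreeGroup (Fin k), ∀ a : Fin k,
      ∀ ℓg ℓh : List (Fin k × Bool),
        IsCyclRep (φ g) ℓg → IsCyclRep (φ h) ℓh →
          nLetter ℓg a = nLetter ℓh a) := by
  constructor
  · intro H φ a ℓg ℓh hℓg hℓh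
    have key (b : Fin k) : nLetter ℓg a + nLetter ℓh b = nLetter ℓh a + nLetter ℓg b := by
      by_cases hab : a = b
      · rw [hab, add_comm]
      · have h1 := hℓg.cyclLen_transvection_add hab
        have h2 := hℓh.cyclLen_transvection_add hab
        have h3 := H (φ.trans (transvection hab))
        have h4 := H (φ.trans ((invSwap a b).trans (transvection hab)))
        simp only [MulEquiv.trans_apply] at h3 h4
        lia
    have hsum := Finset.sum_congr rfl fun b (_ : b ∈ Finset.univ) => key b
    have hlen : ℓg.length = ℓh.length := by rw [hℓg.2.2, hℓh.2.2, H φ]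
    simp only [Finset.sum_add_distrib, sum_nLetter, hlen, Finset.sum_const, Finset.card_univ,
      Fintype.card_fin, smul_eq_mul] at hsum
    exact Nat.eq_of_mul_eq_mul_left (by lia) (Nat.add_right_cancel hsum)
  · intro H φ
    obtain ⟨ℓg, hℓg⟩ := exists_isCyclRep (φ g)
    obtain ⟨ℓh, hℓh⟩ := exists_isCyclRep (φ h)
    rw [← hℓg.2.2, ← hℓh.2.2, ← sum_nLetter, ← sum_nLetter]
    exact Finset.sum_congr rfl fun a _ => H φ a ℓg ℓh hℓg hℓh
end

section
/- Let k ≥ 2 and let g, h ∈ F = FreeGroup (Fin k). Then the following are equivalent: (i) ‖φ g‖ = ‖φ h‖ for every automorphism φ of F; (ii) ‖ψ g‖ = ‖ψ h‖ for every injective group homomorphism (endomorphism) ψ : F →* F; (iii) for every m : ℕ and every injective group homomorphism ψ : F →* FreeGroup (Fin m), ‖ψ g‖ = ‖ψ h‖. -/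
namespace FreeGroup

section Overlap

variable {α : Type*}

/-- The inverse of a letter. -/
def letterInv (y : α × Bool) : α × Bool := (y.1, !y.2)

@[simp] lemma letterInv_letterInv (y : α × Bool) : letterInv (letterInv y) = y := by
  simp [letterInv]

lemma mk_letterInv (y : α × Bool) : mk [letterInv y] = (mk [y])⁻¹ := by
  simp [letterInv, inv_mk, invRev]

lemma mk_cons (y : α × Bool) (L : List (α × Bool)) : mk (y :: L) = mk [y] * mk L := by
  rw [mul_mk]; rfl

lemma same_sign_iff (y z : α × Bool) : (y.1 = z.1 → y.2 = z.2) ↔ z ≠ letterInv y := by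
  obtain ⟨a, s⟩ := y
  obtain ⟨b, t⟩ := z
  cases s <;> cases t <;> simp [letterInv, eq_comm]

lemma isReduced_cons_iff {y : α × Bool} {L : List (α × Bool)} :
    IsReduced (y :: L) ↔ (∀ z ∈ L.head?, z ≠ letterInv y) ∧ IsReduced L := by
  simp only [IsReduced, List.isChain_cons, same_sign_iff]

lemma isReduced_cons_cons_iff {y z : α × Bool} {L : List (α × Bool)} :
    IsReduced (y :: z :: L) ↔ z ≠ letterInv y ∧ IsReduced (z :: L) := by
  rw [isReduced_cons_iff]; simp

variable [DecidableEq α]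

lemma norm_mk_of_isReduced {L : List (α × Bool)} (h : IsReduced L) : (mk L).norm = L.length := by
  rw [norm, toWord_mk, h.reduce_eq]

/-- The length of the longest common initial segment of two lists. -/
def prefixLen {γ : Type*} [DecidableEq γ] : List γ → List γ → ℕ
  | a :: l, b :: l' => if a = b then prefixLen l l' + 1 else 0
  | _, _ => 0

lemma min_prefixLen_le {γ : Type*} [DecidableEq γ] (l₁ l₂ l₃ : List γ) :
    min (prefixLen l₁ l₂) (prefixLen l₂ l₃) ≤ prefixLen l₁ l₃ := by
  induction l₁ generalizing l₂ l₃ with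
  | nil => simp [prefixLen]
  | cons a l ih =>
    cases l₂ with
    | nil => simp [prefixLen]
    | cons b l₂ =>
      cases l₃ with
      | nil => simp [prefixLen]
      | cons c l₃ =>
        have := ih l₂ l₃
        simp only [prefixLen]
        split_ifs <;> grind

lemma take_prefixLen {γ : Type*} [DecidableEq γ] (l₁ l₂ : List γ) :
    l₁.take (prefixLen l₁ l₂) = l₂.take (prefixLen l₁ l₂) := by
  induction l₁ generalizing l₂ with
  | nil => simp [prefixLen]
  | cons a l ih =>
    cases l₂ with
    | nil => simp [prefixLen]
    | cons b l₂ =>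
      simp only [prefixLen]
      split_ifs with h
      · simp [h, ih]
      · simp

lemma norm_inv_mk_mul_mk {l₁ l₂ : List (α × Bool)} (h₁ : IsReduced l₁) (h₂ : IsReduced l₂) :
    ((mk l₁)⁻¹ * mk l₂).norm + 2 * prefixLen l₁ l₂ = l₁.length + l₂.length := by
  induction l₁ generalizing l₂ with
  | nil =>
    rw [show (mk ([] : List (α × Bool))) = 1 from rfl]
    simp [prefixLen, norm_mk_of_isReduced h₂]
  | cons a l ih =>
    cases l₂ with
    | nil =>
      rw [show (mk ([] : List (α × Bool))) = 1 from rfl]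
      rw [mul_one, norm_inv_eq, norm_mk_of_isReduced h₁]
      simp [prefixLen]
    | cons b l₂ =>
      simp only [prefixLen]
      split_ifs with h
      · subst h
        have := ih (isReduced_cons_iff.1 h₁).2 (isReduced_cons_iff.1 h₂).2
        rw [mk_cons a l, mk_cons a l₂, show (mk [a] * mk l)⁻¹ * (mk [a] * mk l₂)
          = (mk l)⁻¹ * mk l₂ by group]
        simp only [List.length_cons]
        omega
      · have hred : IsReduced (invRev (a :: l) ++ b :: l₂) := by
          have h₁' : IsReduced (invRev (a :: l)) := by
            rw [isReduced_iff_reduce_eq, reduce_invRev, h₁.reduce_eq]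
          rw [IsReduced, List.isChain_append]
          refine ⟨h₁', h₂, ?_⟩
          intro x hx y hy
          simp only [invRev, List.map_cons, List.reverse_cons, List.getLast?_append,
            List.getLast?_singleton, Option.some_or, Option.mem_def, Option.some.injEq,
            List.head?_cons] at hx hy
          subst hx hy
          rw [same_sign_iff]
          simpa [letterInv, eq_comm] using h
        rw [inv_mk, mul_mk, norm_mk_of_isReduced hred]
        simp [invRev_length]

/-- The length of the longest common initial segment of two elements of a free group. -/
def overlap (u v : FreeGroup α) : ℕ := prefixLen u.toWord v.toWord

lemma norm_inv_mul (u v : FreeGroup α) :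
    (u⁻¹ * v).norm + 2 * overlap u v = u.norm + v.norm := by
  have := norm_inv_mk_mul_mk (isReduced_toWord (x := u)) (isReduced_toWord (x := v))
  rwa [mk_toWord, mk_toWord] at this

lemma norm_mul (u v : FreeGroup α) :
    (u * v).norm + 2 * overlap u⁻¹ v = u.norm + v.norm := by
  simpa using norm_inv_mul u⁻¹ v

lemma overlap_comm (u v : FreeGroup α) : overlap u v = overlap v u := by
  have h₁ := norm_inv_mul u v
  have h₂ := norm_inv_mul v u
  rw [← norm_inv_eq, mul_inv_rev, inv_inv] at h₂
  omega

lemma min_overlap_le (u v w : FreeGroup α) :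
    min (overlap u v) (overlap v w) ≤ overlap u w :=
  min_prefixLen_le _ _ _

lemma overlap_eq_of_lt {u v w : FreeGroup α} (h : overlap u v < overlap v w) :
    overlap u w = overlap u v := by
  have h₁ := min_overlap_le u v w
  have h₂ := min_overlap_le u w v
  rw [overlap_comm w v] at h₂
  omega

lemma norm_pow_eq (x : FreeGroup α) {n : ℕ} (hn : n ≠ 0) :
    (x ^ n).norm = n * (reduceCyclically x.toWord).length
      + 2 * (reduceCyclically.conjugator x.toWord).length := by
  rw [norm, toWord_pow, reduceCyclically.reduce_flatten_replicate isReduced_toWord]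
  simp [hn, invRev_length]
  ring

lemma reduceCyclically_toWord_ne_nil {x : FreeGroup α} (hx : x ≠ 1) :
    reduceCyclically x.toWord ≠ [] := by
  intro h
  have := congrArg mk (reduceCyclically.conj_conjugator_reduceCyclically x.toWord)
  rw [h, mk_toWord, ← mul_mk, ← mul_mk, ← inv_mk,
    show (mk ([] : List (α × Bool))) = 1 from rfl, mul_one, mul_inv_cancel] at this
  exact hx this.symm

lemma two_mul_overlap_inv_self_lt {x : FreeGroup α} (hx : x ≠ 1) :
    2 * overlap x⁻¹ x < x.norm := by
  have h₁ := norm_mul x x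
  have h₂ := norm_pow_eq x two_ne_zero
  have h₃ := norm_pow_eq x one_ne_zero
  have h₄ := List.length_pos_iff.2 (reduceCyclically_toWord_ne_nil hx)
  rw [pow_two] at h₂
  rw [pow_one] at h₃
  omega

end Overlap

section CyclLen

variable {α : Type*} [DecidableEq α]

lemma cyclLen_conj (t x : FreeGroup α) : cyclLen (t * x * t⁻¹) = cyclLen x := by
  unfold cyclLen
  congr 1
  ext n
  constructor
  · rintro ⟨s, hs⟩
    exact ⟨s * t, by rw [← hs]; congr 1; group⟩
  · rintro ⟨s, hs⟩
    exact ⟨s * t⁻¹, by rw [← hs]; congr 1; group⟩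

lemma norm_pow_le (x : FreeGroup α) (n : ℕ) : (x ^ n).norm ≤ n * x.norm := by
  induction n with
  | zero => simp
  | succ n ih =>
    have := norm_mul_le (x ^ n) x
    rw [pow_succ, add_mul]
    omega

lemma exists_conj_mk_isCyclicallyReduced (x : FreeGroup α) :
    ∃ t C, x = t * mk C * t⁻¹ ∧ IsCyclicallyReduced C :=
  ⟨mk (reduceCyclically.conjugator x.toWord), reduceCyclically x.toWord, by
    rw [inv_mk, mul_mk, mul_mk, reduceCyclically.conj_conjugator_reduceCyclically, mk_toWord],
    reduceCyclically.isCyclicallyReduced isReduced_toWord⟩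

/-- The cyclically reduced length is the growth rate of the norm of the powers. -/
lemma cyclLen_eq_of_norm_pow {x : FreeGroup α} {S K : ℤ}
    (h : ∀ n : ℕ, n ≠ 0 → ((x ^ n).norm : ℤ) = n * S + K) : (cyclLen x : ℤ) = S := by
  set c := (reduceCyclically x.toWord).length with hc
  have hS : S = c := by
    have h₁ := h 1 one_ne_zero
    have h₂ := h 2 two_ne_zero
    rw [norm_pow_eq x one_ne_zero, ← hc] at h₁
    rw [norm_pow_eq x two_ne_zero, ← hc] at h₂
    push_cast at h₁ h₂
    linarith
  rw [hS]
  congr 1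
  have hmem : ∃ t : FreeGroup α, FreeGroup.norm (t * x * t⁻¹) = c := by
    refine ⟨(mk (reduceCyclically.conjugator x.toWord))⁻¹, ?_⟩
    have := congrArg mk (reduceCyclically.conj_conjugator_reduceCyclically x.toWord)
    rw [mk_toWord, ← mul_mk, ← mul_mk, ← inv_mk] at this
    rw [hc, ← norm_mk_of_isReduced
      (reduceCyclically.isCyclicallyReduced (isReduced_toWord (x := x))).1]
    congr 1
    nth_rewrite 2 [← this]
    group
  refine le_antisymm (Nat.sInf_le hmem) (le_csInf ⟨_, hmem⟩ ?_)
  rintro n ⟨t, rfl⟩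
  by_contra! hlt
  set y := t * x * t⁻¹ with hy
  set N := 2 * t.norm + 1 with hN
  have h₁ : (x ^ N).norm ≤ t.norm + (y ^ N).norm + t.norm := by
    have e : x ^ N = t⁻¹ * y ^ N * t := by rw [hy, conj_pow]; group
    have a₁ := norm_mul_le (t⁻¹ * y ^ N) t
    have a₂ := norm_mul_le t⁻¹ (y ^ N)
    rw [norm_inv_eq] at a₂
    rw [e]
    omega
  have h₂ := norm_pow_le y N
  rw [norm_pow_eq x (by omega), ← hc] at h₁
  have h₃ : N * (y.norm + 1) ≤ N * c := Nat.mul_le_mul_left _ hlt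
  rw [mul_add] at h₃
  omega

end CyclLen

section LengthFormula

variable {α β : Type*} [DecidableEq β]

/-- The amount of cancellation between the images of the letters `y` and `z`. -/
def cancellation (f : FreeGroup α →* FreeGroup β) (y z : α × Bool) : ℕ :=
  overlap (f (mk [y]))⁻¹ (f (mk [z]))

/-- The image of a reduced word is obtained by cancelling between the images of adjacent letters
only. -/
def HasLocalCancellation (f : FreeGroup α →* FreeGroup β) : Prop :=
  ∀ (x y : α × Bool) (L : List (α × Bool)), IsReduced (x :: y :: L) →
    overlap (f (mk [x]))⁻¹ (f (mk (y :: L))) = cancellation f x y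

/-- The contribution of a pair of adjacent letters to the length of the image of a word. -/
def pairWeight (f : FreeGroup α →* FreeGroup β) (p : (α × Bool) × (α × Bool)) : ℤ :=
  (f (mk [p.1])).norm - 2 * cancellation f p.1 p.2

/-- The pairs of cyclically adjacent letters of a word. -/
def cyclicPairs {γ : Type*} (C : List γ) : List (γ × γ) := C.zip (C.rotate 1)

lemma HasLocalCancellation.norm_append {f : FreeGroup α →* FreeGroup β}
    (hf : HasLocalCancellation f) (C L : List (α × Bool)) (z : α × Bool)
    (h : IsReduced (C ++ z :: L)) :
    ((f (mk (C ++ z :: L))).norm : ℤ) =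
      ((C.zip (C.tail ++ [z])).map (pairWeight f)).sum + (f (mk (z :: L))).norm := by
  induction C with
  | nil => simp
  | cons y C ih =>
    have key : ∀ (w : α × Bool) (M : List (α × Bool)), IsReduced (y :: w :: M) →
        ((f (mk (y :: w :: M))).norm : ℤ) = pairWeight f (y, w) + (f (mk (w :: M))).norm := by
      intro w M hM
      have h₁ := hf y w M hM
      have h₂ := norm_mul (f (mk [y])) (f (mk (w :: M)))
      rw [← f.map_mul, ← mk_cons, h₁] at h₂
      simp only [pairWeight]
      omega
    have ih := ih (isReduced_cons_iff.1 h).2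
    cases C with
    | nil => simpa using key z L h
    | cons w C =>
      have hkey := key w (C ++ z :: L) h
      simp only [List.cons_append] at ih ⊢
      rw [hkey, ih]
      simp [add_assoc]

lemma HasLocalCancellation.cyclLen_eq {f : FreeGroup α →* FreeGroup β}
    (hf : HasLocalCancellation f) {C : List (α × Bool)} (hC : IsCyclicallyReduced C) :
    (cyclLen (f (mk C)) : ℤ) = ((cyclicPairs C).map (pairWeight f)).sum := by
  refine cyclLen_eq_of_norm_pow
    (K := (f (mk C)).norm - ((cyclicPairs C).map (pairWeight f)).sum) ?_
  intro n hn
  induction n with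
  | zero => exact absurd rfl hn
  | succ n ih =>
    rcases Nat.eq_zero_or_pos n with rfl | hpos
    · simp
    · have ih := ih hpos.ne'
      cases C with
      | nil =>
        rw [show (mk ([] : List (α × Bool))) = 1 from rfl]
        simp [cyclicPairs]
      | cons z C =>
        obtain ⟨m, rfl⟩ := Nat.exists_eq_add_one_of_ne_zero hpos.ne'
        have hred := (hC.flatten_replicate (m + 1 + 1)).1
        have e₁ : (List.replicate (m + 1) (z :: C)).flatten =
            z :: (C ++ (List.replicate m (z :: C)).flatten) := by
          simp [List.replicate_succ]
        have e₂ : (List.replicate (m + 1 + 1) (z :: C)).flatten =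
            (z :: C) ++ z :: (C ++ (List.replicate m (z :: C)).flatten) := by
          rw [List.replicate_succ, List.flatten_cons, e₁]
        rw [← f.map_pow, pow_mk, e₁] at ih
        rw [e₂] at hred
        rw [← f.map_pow, pow_mk, e₂, hf.norm_append _ _ _ hred, ih]
        simp only [cyclicPairs, List.tail_cons, List.rotate_cons_succ, List.rotate_zero]
        push_cast
        ring

end LengthFormula

section NielsenReduced

variable {α β : Type*} [DecidableEq β]

/-- The images of the letters satisfy the strict Nielsen condition: no image of a letter is
swallowed by the cancellation with its two neighbours. -/
def IsNielsenReduced (f : FreeGroup α →* FreeGroup β) : Prop :=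
  ∀ x y z : α × Bool, y ≠ letterInv x → z ≠ letterInv y →
    cancellation f x y + cancellation f y z < (f (mk [y])).norm

lemma IsNielsenReduced.hasLocalCancellation {f : FreeGroup α →* FreeGroup β}
    (hf : IsNielsenReduced f) : HasLocalCancellation f := by
  intro x y L h
  induction L generalizing x y with
  | nil => rfl
  | cons z L ih =>
    obtain ⟨hxy, h'⟩ := isReduced_cons_cons_iff.1 h
    obtain ⟨hyz, -⟩ := isReduced_cons_cons_iff.1 h'
    have h₁ := ih y z h'
    have h₂ := norm_mul (f (mk [y])) (f (mk (z :: L)))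
    have h₃ := norm_inv_mul (f (mk [y])) (f (mk [y]) * f (mk (z :: L)))
    rw [inv_mul_cancel_left] at h₃
    have h₄ := hf x y z hxy hyz
    rw [mk_cons y, f.map_mul]
    refine overlap_eq_of_lt (v := f (mk [y])) ?_
    change cancellation f x y < _
    omega

end NielsenReduced

section Transvection

variable {α : Type*}

lemma mk_singleton_eq (y : α × Bool) : mk [y] = if y.2 then of y.1 else (of y.1)⁻¹ := by
  obtain ⟨i, s⟩ := y
  cases s
  · exact mk_letterInv (i, true)
  · rfl

variable [DecidableEq α]

/-- The endomorphism of a free group which maps the letter `p` to `p * b` and fixes the other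
basis elements. -/
def transvectionHom (p b : α × Bool) : FreeGroup α →* FreeGroup α :=
  lift fun i ↦ if i = p.1 then (if p.2 then of i * mk [b] else (mk [b])⁻¹ * of i) else of i

lemma transvectionHom_of_ne (p b : α × Bool) {i : α} (h : i ≠ p.1) :
    transvectionHom p b (of i) = of i := by
  simp [transvectionHom, h]

lemma transvectionHom_mk_of_ne (p b : α × Bool) {y : α × Bool} (h : y.1 ≠ p.1) :
    transvectionHom p b (mk [y]) = mk [y] := by
  rw [mk_singleton_eq]
  split_ifs <;> simp [transvectionHom_of_ne p b h]

lemma transvectionHom_mk_self (p b : α × Bool) :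
    transvectionHom p b (mk [p]) = mk [p] * mk [b] := by
  rw [mk_singleton_eq p]
  split_ifs with h <;> simp [transvectionHom, h]

lemma transvectionHom_comp (p b : α × Bool) (h : b.1 ≠ p.1) :
    (transvectionHom p b).comp (transvectionHom p (letterInv b)) = MonoidHom.id _ := by
  have hp : transvectionHom p b (transvectionHom p (letterInv b) (mk [p])) = mk [p] := by
    rw [transvectionHom_mk_self, _root_.map_mul, transvectionHom_mk_self, mk_letterInv,
      _root_.map_inv, transvectionHom_mk_of_ne p b h, mul_inv_cancel_right]
  ext i
  by_cases hi : i = p.1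
  · subst hi
    rw [mk_singleton_eq] at hp
    split_ifs at hp
    · simpa using hp
    · simpa using hp
  · simp [transvectionHom_of_ne _ _ hi]

/-- The automorphism of a free group which maps the letter `p` to `p * b` and fixes the other
basis elements. -/
def transvection (p b : α × Bool) (h : b.1 ≠ p.1) : FreeGroup α ≃* FreeGroup α :=
  MonoidHom.toMulEquiv (transvectionHom p b) (transvectionHom p (letterInv b))
    (by simpa using transvectionHom_comp p (letterInv b) h)
    (transvectionHom_comp p b h)

lemma exists_isReduced_transvectionHom {p b : α × Bool} (h : b.1 ≠ p.1) (w : List (α × Bool))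
    (hw : IsReduced w) :
    ∃ T, IsReduced T ∧ mk T = transvectionHom p b (mk w) ∧ (w = [] → T = []) ∧
      ∀ y, w.head? = some y →
        (y = p ∧ ∃ R, T = p :: R) ∨
        (y = letterInv p ∧ ∃ R, T = letterInv b :: letterInv p :: R) ∨
        (y = letterInv b ∧ ∃ R, T = letterInv b :: R ∧ R.head? ≠ some (letterInv p)) ∨
        (y = b ∧ ∃ R, T = b :: R ∨ T = letterInv p :: R) ∨
        (y.1 ≠ p.1 ∧ y.1 ≠ b.1 ∧ ∃ R, T = y :: R) := by
  have hfix : transvectionHom p b (mk [b]) = mk [b] := transvectionHom_mk_of_ne p b h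
  have hI : ∀ {x y : α × Bool}, letterInv x = letterInv y ↔ x = y := fun {x y} ↦
    ⟨fun e ↦ by simpa using congrArg letterInv e, fun e ↦ by rw [e]⟩
  have hI' : ∀ {x y : α × Bool}, x = letterInv y ↔ letterInv x = y := fun {x y} ↦ by
    rw [← hI, letterInv_letterInv]
  have h1 : ∀ x : α × Bool, (letterInv x).1 = x.1 := fun x ↦ rfl
  have hne : ∀ x : α × Bool, x ≠ letterInv x := fun x e ↦ by
    have := congrArg Prod.snd e; simp [letterInv] at this
  have hor : ∀ x y : α × Bool, x.1 = y.1 → x = y ∨ x = letterInv y := by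
    rintro ⟨i, s⟩ ⟨j, t⟩ (rfl : i = j)
    cases s <;> cases t <;> simp [letterInv]
  induction w with
  | nil => exact ⟨[], hw, by simp [show (mk ([] : List (α × Bool))) = 1 from rfl], by simp, by simp⟩
  | cons y w ih =>
    obtain ⟨hyw, hw'⟩ := isReduced_cons_iff.1 hw
    obtain ⟨T, hT, hmk, hnil, hhead⟩ := ih hw'
    have hmk' : transvectionHom p b (mk (y :: w)) = transvectionHom p b (mk [y]) * mk T := by
      rw [mk_cons, _root_.map_mul, hmk]
    by_cases hyp : y = p
    · subst hyp
      rw [transvectionHom_mk_self] at hmk'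
      by_cases hb : w.head? = some (letterInv b)
      · obtain ⟨R, rfl, hR⟩ : ∃ R, T = letterInv b :: R ∧ R.head? ≠ some (letterInv y) := by
          have := hhead _ hb
          grind
        refine ⟨y :: R, ?_, ?_, by simp, by simp⟩
        · exact isReduced_cons_iff.2
            ⟨fun z hz e ↦ hR (e ▸ hz), (isReduced_cons_iff.1 hT).2⟩
        · rw [hmk', mk_cons y R, mk_cons (letterInv b) R, mk_letterInv]
          group
      · refine ⟨y :: b :: T, ?_, ?_, by simp, by simp⟩
        · rw [isReduced_cons_cons_iff, isReduced_cons_iff]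
          refine ⟨by grind, ?_, hT⟩
          intro z hz
          cases w with
          | nil => grind
          | cons v w =>
            have := hhead v rfl
            have := hor v y
            grind
        · rw [hmk', mk_cons y, mk_cons b, mul_assoc]
    by_cases hyp' : y = letterInv p
    · subst hyp'
      rw [mk_letterInv, _root_.map_inv, transvectionHom_mk_self] at hmk'
      refine ⟨letterInv b :: letterInv p :: T, ?_, ?_, by simp, by simp⟩
      · rw [isReduced_cons_cons_iff, isReduced_cons_iff]
        refine ⟨by grind, ?_, hT⟩
        intro z hz
        cases w with
        | nil => grind
        | cons v w =>
          have := hhead v rfl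
          grind
      · rw [hmk', mk_cons, mk_cons (letterInv p), mk_letterInv, mk_letterInv]
        group
    have hyp1 : y.1 ≠ p.1 := by
      intro e
      have := hor _ _ e
      tauto
    rw [transvectionHom_mk_of_ne p b hyp1] at hmk'
    by_cases hpb : y = b ∧ w.head? = some (letterInv p)
    · obtain ⟨rfl, hp⟩ := hpb
      obtain ⟨R, rfl⟩ : ∃ R, T = letterInv y :: letterInv p :: R := by
        have := hhead _ hp
        grind
      refine ⟨letterInv p :: R, (isReduced_cons_iff.1 hT).2, ?_, by simp, by simp⟩
      rw [hmk', mk_cons (letterInv y), mk_letterInv y, mul_inv_cancel_left]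
    · refine ⟨y :: T, ?_, ?_, by simp, ?_⟩
      · rw [isReduced_cons_iff]
        refine ⟨?_, hT⟩
        intro z hz
        cases w with
        | nil => grind
        | cons v w =>
          have := hhead v rfl
          grind
      · rw [hmk', mk_cons y]
      · intro z hz
        obtain rfl : y = z := by simpa using hz
        by_cases hb' : y = letterInv b
        · have : T.head? ≠ some (letterInv p) := by
            cases w with
            | nil => grind
            | cons v w =>
              have := hhead v rfl
              grind
          grind
        · have := hor y b
          grind

lemma toWord_transvectionHom {p b : α × Bool} (h : b.1 ≠ p.1) (y : α × Bool) :
    (transvectionHom p b (mk [y])).toWord =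
      if y = p then [p, b] else if y = letterInv p then [letterInv b, letterInv p] else [y] := by
  split_ifs with h₁ h₂
  · subst h₁
    rw [transvectionHom_mk_self, ← mk_cons, toWord_mk, IsReduced.reduce_eq]
    simp [IsReduced, h.symm]
  · subst h₂
    rw [mk_letterInv, _root_.map_inv, transvectionHom_mk_self, mul_inv_rev, ← mk_letterInv,
      ← mk_letterInv, ← mk_cons, toWord_mk, IsReduced.reduce_eq]
    simp [IsReduced, letterInv, h]
  · have : y.1 ≠ p.1 := by
      intro e
      obtain ⟨i, s⟩ := y
      obtain ⟨j, t⟩ := p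
      cases s <;> cases t <;> simp_all [letterInv]
    rw [transvectionHom_mk_of_ne p b this]
    rfl

lemma cancellation_eq_prefixLen (f : FreeGroup α →* FreeGroup α) (x y : α × Bool) :
    cancellation f x y = prefixLen (f (mk [letterInv x])).toWord (f (mk [y])).toWord := by
  rw [cancellation, overlap, mk_letterInv, _root_.map_inv]

lemma cancellation_transvectionHom {p b : α × Bool} (h : b.1 ≠ p.1) {x y : α × Bool}
    (hxy : y ≠ letterInv x) : cancellation (transvectionHom p b) x y =
      if (x, y) = (p, letterInv b) ∨ (x, y) = (b, letterInv p) then 1 else 0 := by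
  rw [cancellation_eq_prefixLen, toWord_transvectionHom h, toWord_transvectionHom h]
  obtain ⟨i, s⟩ := x
  obtain ⟨j, t⟩ := y
  obtain ⟨c, u⟩ := p
  obtain ⟨d, v⟩ := b
  simp only [letterInv, Prod.mk.injEq] at *
  split_ifs <;> simp only [prefixLen] <;> grind

lemma hasLocalCancellation_transvectionHom {p b : α × Bool} (h : b.1 ≠ p.1) :
    HasLocalCancellation (transvectionHom p b) := by
  intro x y L hL
  obtain ⟨hxy, hL'⟩ := isReduced_cons_cons_iff.1 hL
  obtain ⟨T, hT, hmk, -, hhead⟩ := exists_isReduced_transvectionHom h _ hL'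
  have := hhead y rfl
  rw [cancellation_eq_prefixLen, overlap, ← _root_.map_inv, ← mk_letterInv, ← hmk, toWord_mk,
    hT.reduce_eq, toWord_transvectionHom h, toWord_transvectionHom h]
  obtain ⟨i, s⟩ := x
  obtain ⟨j, t⟩ := y
  obtain ⟨c, u⟩ := p
  obtain ⟨d, v⟩ := b
  simp only [letterInv, Prod.mk.injEq] at *
  rcases this with ⟨_, R, rfl⟩ | ⟨_, R, rfl⟩ | ⟨_, R, rfl, hR⟩ | ⟨_, R, rfl | rfl⟩ | ⟨_, _, R, rfl⟩ <;>
  split_ifs <;> simp only [prefixLen] <;> first | grind | (cases R <;> simp only [prefixLen] <;> grind)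

end Transvection

section Counting

lemma map_fst_cyclicPairs {γ : Type*} (C : List γ) : (cyclicPairs C).map Prod.fst = C :=
  List.map_fst_zip (by simp)

lemma map_snd_cyclicPairs {γ : Type*} (C : List γ) :
    (cyclicPairs C).map Prod.snd = C.rotate 1 :=
  List.map_snd_zip (by simp)

lemma rel_of_mem_zip_tail {γ : Type*} {R : γ → γ → Prop} {L : List γ} (h : L.IsChain R) {x y : γ}
    (hxy : (x, y) ∈ L.zip L.tail) : R x y := by
  induction L with
  | nil => simp at hxy
  | cons z L ih =>
    cases L with
    | nil => simp at hxy
    | cons w L =>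
      rw [List.isChain_cons_cons] at h
      rcases List.mem_cons.1 (show (x, y) ∈ (z, w) :: (w :: L).zip L from hxy) with e | e
      · obtain ⟨rfl, rfl⟩ := Prod.mk.inj e
        exact h.1
      · exact ih h.2 e

lemma IsCyclicallyReduced.ne_letterInv_of_mem {α : Type*} {C : List (α × Bool)}
    (hC : IsCyclicallyReduced C) {x y : α × Bool} (h : (x, y) ∈ cyclicPairs C) :
    y ≠ letterInv x := by
  rw [← same_sign_iff]
  cases C with
  | nil => simp [cyclicPairs] at h
  | cons z C =>
    have hred : IsReduced ((z :: C) ++ [z]) := by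
      have := (hC.flatten_replicate 2).1
      simp only [List.replicate_succ, List.flatten_cons, List.replicate_zero, List.flatten_nil,
        List.append_nil] at this
      exact List.IsChain.left_of_append (l₂ := C) (by simpa [IsReduced] using this)
    have e : ((z :: C) ++ [z]).zip ((z :: C) ++ [z]).tail = cyclicPairs (z :: C) := by
      have := List.zip_append (l₁ := z :: C) (r₁ := [z]) (l₂ := C ++ [z]) (r₂ := []) (by simp)
      simpa [cyclicPairs] using this
    exact rel_of_mem_zip_tail hred (e ▸ h)

lemma sum_count_pair_left {γ : Type*} [Fintype γ] [BEq γ] [LawfulBEq γ] (P : List (γ × γ)) (x : γ) :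
    ∑ y, P.count (x, y) = (P.map Prod.fst).count x := by
  classical
  induction P with
  | nil => simp
  | cons q P ih =>
    obtain ⟨a, b⟩ := q
    simp only [List.count_cons, Finset.sum_add_distrib, ih, List.map_cons, beq_iff_eq,
      Prod.mk.injEq]
    by_cases h : a = x <;> simp [h]

lemma sum_count_pair_right {γ : Type*} [Fintype γ] [BEq γ] [LawfulBEq γ] (P : List (γ × γ)) (y : γ) :
    ∑ x, P.count (x, y) = (P.map Prod.snd).count y := by
  classical
  induction P with
  | nil => simp
  | cons q P ih =>
    obtain ⟨a, b⟩ := q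
    simp only [List.count_cons, Finset.sum_add_distrib, ih, List.map_cons, beq_iff_eq,
      Prod.mk.injEq]
    by_cases h : b = y <;> simp [h]

lemma sum_map_eq_sum_count {γ : Type*} [Fintype γ] [BEq γ] [LawfulBEq γ] (P : List γ) (F : γ → ℤ) :
    (P.map F).sum = ∑ q, (P.count q : ℤ) * F q := by
  classical
  induction P with
  | nil => simp
  | cons a P ih =>
    simp [List.count_cons, add_mul, Finset.sum_add_distrib, ih, add_comm]

variable {α : Type*}

lemma cancellation_letterInv {β : Type*} [DecidableEq β] (f : FreeGroup α →* FreeGroup β)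
    (x y : α × Bool) : cancellation f (letterInv y) (letterInv x) = cancellation f x y := by
  rw [cancellation, cancellation, mk_letterInv, mk_letterInv, _root_.map_inv, _root_.map_inv,
    inv_inv, overlap_comm]

lemma norm_map_letter {β : Type*} [DecidableEq β] (f : FreeGroup α →* FreeGroup β)
    (y : α × Bool) : (f (mk [y])).norm = (f (of y.1)).norm := by
  rw [mk_singleton_eq]
  split_ifs <;> simp [norm_inv_eq]

variable [DecidableEq α]

/-- The number of occurrences of the basis element `i` and its inverse in a word. -/
def occurrences (C : List (α × Bool)) (i : α) : ℕ := C.countP fun y ↦ y.1 = i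

/-- The number of occurrences of the two-letter word `x y` and its inverse in a cyclic word. -/
def turns (C : List (α × Bool)) (x y : α × Bool) : ℕ :=
  (cyclicPairs C).count (x, y) + (cyclicPairs C).count (letterInv y, letterInv x)

lemma turns_letterInv (C : List (α × Bool)) (x y : α × Bool) :
    turns C (letterInv y) (letterInv x) = turns C x y := by
  simp [turns, add_comm]

lemma IsCyclicallyReduced.turns_letterInv_self {C : List (α × Bool)}
    (hC : IsCyclicallyReduced C) (x : α × Bool) : turns C x (letterInv x) = 0 := by
  simp only [turns, letterInv_letterInv]
  have : (x, letterInv x) ∉ cyclicPairs C := fun h ↦ hC.ne_letterInv_of_mem h rfl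
  simp [List.count_eq_zero_of_not_mem this]

lemma count_add_count_letterInv (C : List (α × Bool)) (x : α × Bool) :
    C.count x + C.count (letterInv x) = occurrences C x.1 := by
  obtain ⟨i, s⟩ := x
  induction C with
  | nil => simp [occurrences]
  | cons y C ih =>
    obtain ⟨j, t⟩ := y
    simp only [occurrences, List.count_cons, List.countP_cons, letterInv] at ih ⊢
    by_cases h : j = i
    · cases s <;> cases t <;> simp_all <;> omega
    · simp_all

lemma sum_occurrences [Fintype α] (C : List (α × Bool)) : ∑ i, occurrences C i = C.length := by
  induction C with
  | nil => simp [occurrences]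
  | cons y C ih =>
    simp only [occurrences, List.countP_cons, List.length_cons, Finset.sum_add_distrib] at ih ⊢
    rw [ih]
    simp

lemma sum_turns [Fintype α] (C : List (α × Bool)) (x : α × Bool) :
    ∑ y, turns C x y = occurrences C x.1 := by
  have hinv : Function.Involutive (letterInv : α × Bool → α × Bool) := letterInv_letterInv
  have hsum : ∑ y, (cyclicPairs C).count (letterInv y, letterInv x) =
      ∑ y, (cyclicPairs C).count (y, letterInv x) :=
    Equiv.sum_comp hinv.toPerm fun y ↦ (cyclicPairs C).count (y, letterInv x)
  simp only [turns, Finset.sum_add_distrib]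
  rw [sum_count_pair_left, hsum, sum_count_pair_right,
    map_fst_cyclicPairs, map_snd_cyclicPairs, (List.rotate_perm C 1).count_eq,
    count_add_count_letterInv]

lemma cyclLen_mk {C : List (α × Bool)} (hC : IsCyclicallyReduced C) :
    cyclLen (mk C) = C.length := by
  have := cyclLen_eq_of_norm_pow (x := mk C) (S := C.length) (K := 0) fun n _ ↦ by
    rw [pow_mk, norm_mk_of_isReduced (hC.flatten_replicate n).1]
    simp
  exact_mod_cast this

lemma sum_map_occurrences [Fintype α] (C : List (α × Bool)) (F : α → ℤ) :
    (C.map fun y ↦ F y.1).sum = ∑ i, (occurrences C i : ℤ) * F i := by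
  induction C with
  | nil => simp [occurrences]
  | cons y C ih =>
    simp only [occurrences, List.countP_cons, List.map_cons, List.sum_cons] at ih ⊢
    rw [ih]
    simp [add_mul, Finset.sum_add_distrib, add_comm]

lemma sum_pairWeight [Fintype α] {β : Type*} [DecidableEq β] (f : FreeGroup α →* FreeGroup β)
    (C : List (α × Bool)) :
    ((cyclicPairs C).map (pairWeight f)).sum = ∑ i, (occurrences C i : ℤ) * (f (of i)).norm
      - ∑ q : (α × Bool) × (α × Bool), (turns C q.1 q.2 : ℤ) * cancellation f q.1 q.2 := by
  have h₁ : ((cyclicPairs C).map (pairWeight f)).sum =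
      ((cyclicPairs C).map fun q ↦ ((f (of q.1.1)).norm : ℤ)).sum
        - 2 * ((cyclicPairs C).map fun q ↦ (cancellation f q.1 q.2 : ℤ)).sum := by
    generalize cyclicPairs C = P
    induction P with
    | nil => simp
    | cons q P ih =>
      simp only [List.map_cons, List.sum_cons, ih, pairWeight, norm_map_letter]
      ring
  have h₂ : (cyclicPairs C).map (fun q ↦ ((f (of q.1.1)).norm : ℤ)) =
      C.map fun y ↦ ((f (of y.1)).norm : ℤ) := by
    nth_rewrite 2 [← map_fst_cyclicPairs C]
    rw [List.map_map]
    rfl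
  have hinv : Function.Involutive
      fun q : (α × Bool) × (α × Bool) ↦ (letterInv q.2, letterInv q.1) := fun q ↦ by simp
  have h₃ : ∑ q : (α × Bool) × (α × Bool), ((cyclicPairs C).count q : ℤ) * cancellation f q.1 q.2
      = ∑ q : (α × Bool) × (α × Bool), ((cyclicPairs C).count (letterInv q.2, letterInv q.1) : ℤ)
        * cancellation f q.1 q.2 := by
    rw [← Equiv.sum_comp hinv.toPerm]
    refine Finset.sum_congr rfl fun q _ ↦ ?_
    simp [cancellation_letterInv]
  rw [h₁, h₂, sum_map_occurrences C fun i ↦ ((f (of i)).norm : ℤ), sum_map_eq_sum_count]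
  simp only [turns, Nat.cast_add, add_mul, Finset.sum_add_distrib, Prod.mk.eta]
  rw [← h₃]
  ring

lemma cyclLen_transvectionHom {p q : α × Bool} (h : q.1 ≠ p.1) {C : List (α × Bool)}
    (hC : IsCyclicallyReduced C) :
    (cyclLen (transvectionHom p (letterInv q) (mk C)) : ℤ) =
      C.length + occurrences C p.1 - 2 * turns C p q := by
  have h' : (letterInv q).1 ≠ p.1 := h
  rw [(hasLocalCancellation_transvectionHom h').cyclLen_eq hC]
  have h₁ : (cyclicPairs C).map (pairWeight (transvectionHom p (letterInv q))) =
      (cyclicPairs C).map fun r ↦ 1 + (if r.1.1 = p.1 then 1 else 0)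
        - 2 * ((if r = (p, q) then 1 else 0)
          + (if r = (letterInv q, letterInv p) then 1 else 0)) := by
    refine List.map_congr_left ?_
    rintro ⟨x, y⟩ hr
    have hxy := hC.ne_letterInv_of_mem hr
    have hnorm : (((transvectionHom p (letterInv q)) (mk [x])).norm : ℤ) =
        1 + (if x.1 = p.1 then 1 else 0) := by
      rw [norm, toWord_transvectionHom h']
      obtain ⟨i, s⟩ := x
      obtain ⟨j, t⟩ := p
      by_cases hij : i = j
      · cases s <;> cases t <;> simp [letterInv, hij]
      · simp [letterInv, hij]
    rw [pairWeight, hnorm, cancellation_transvectionHom h' hxy, letterInv_letterInv]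
    have hne : (p, q) ≠ (letterInv q, letterInv p) := fun e ↦
      h (congrArg (fun r ↦ r.1.1) e).symm
    split_ifs <;> grind
  have h₂ : ∀ P : List ((α × Bool) × (α × Bool)),
      ((P.map fun r ↦ (1 : ℤ) + (if r.1.1 = p.1 then 1 else 0)
        - 2 * ((if r = (p, q) then 1 else 0)
          + (if r = (letterInv q, letterInv p) then 1 else 0))).sum =
      P.length + occurrences (P.map Prod.fst) p.1
        - 2 * (P.count (p, q) + P.count (letterInv q, letterInv p))) := by
    intro P
    induction P with
    | nil => simp [occurrences]
    | cons r P ih =>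
      simp only [occurrences, List.map_cons, List.sum_cons, List.length_cons, List.countP_cons,
        List.count_cons, beq_iff_eq, decide_eq_true_eq] at ih ⊢
      rw [ih]
      push_cast
      ring
  rw [h₁, h₂, map_fst_cyclicPairs, turns]
  have hlen := congrArg List.length (map_fst_cyclicPairs C)
  rw [List.length_map] at hlen
  rw [hlen]
  push_cast
  ring

/-- The lengths under all automorphisms determine the occurrences and turns of a cyclic word. -/
lemma occurrences_eq_and_turns_eq [Fintype α] {C D : List (α × Bool)}
    (hC : IsCyclicallyReduced C) (hD : IsCyclicallyReduced D)
    (h : ∀ φ : FreeGroup α ≃* FreeGroup α, cyclLen (φ (mk C)) = cyclLen (φ (mk D))) :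
    (∀ i, occurrences C i = occurrences D i) ∧ ∀ x y, turns C x y = turns D x y := by
  have hlen : C.length = D.length := by
    simpa [cyclLen_mk hC, cyclLen_mk hD] using h (MulEquiv.refl _)
  have htr : ∀ p q : α × Bool, q.1 ≠ p.1 →
      (occurrences C p.1 : ℤ) - 2 * turns C p q = occurrences D p.1 - 2 * turns D p q := by
    intro p q hpq
    have h₁ : (cyclLen (transvectionHom p (letterInv q) (mk C)) : ℤ) =
        cyclLen (transvectionHom p (letterInv q) (mk D)) :=
      congrArg Nat.cast (h (transvection p (letterInv q) hpq))
    rw [cyclLen_transvectionHom hpq hC, cyclLen_transvectionHom hpq hD, hlen] at h₁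
    linarith
  have hdiff : ∀ i j : α, (occurrences C i : ℤ) - occurrences D i =
      occurrences C j - occurrences D j := by
    intro i j
    by_cases hij : i = j
    · rw [hij]
    · have h₁ := htr (i, true) (j, true) (Ne.symm hij)
      have h₂ := htr (letterInv (j, true)) (letterInv (i, true)) hij
      rw [turns_letterInv, turns_letterInv] at h₂
      simp only [letterInv] at h₁ h₂
      linarith
  have hocc : ∀ i, occurrences C i = occurrences D i := by
    intro i
    have hsum : ∑ j, ((occurrences C j : ℤ) - occurrences D j) = 0 := by
      rw [Finset.sum_sub_distrib, ← Nat.cast_sum, ← Nat.cast_sum, sum_occurrences,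
        sum_occurrences, hlen, sub_self]
    rw [Finset.sum_congr rfl fun j _ ↦ hdiff j i, Finset.sum_const, nsmul_eq_mul, mul_eq_zero]
      at hsum
    have hcard : ((Finset.univ : Finset α).card : ℤ) ≠ 0 := by
      have : Nonempty α := ⟨i⟩
      simp
    have := hsum.resolve_left hcard
    omega
  have hne : ∀ x y, y ≠ x → turns C x y = turns D x y := by
    intro x y hxy
    by_cases h₁ : y = letterInv x
    · rw [h₁, hC.turns_letterInv_self, hD.turns_letterInv_self]
    · have h₂ : y.1 ≠ x.1 := by
        intro e
        obtain ⟨i, s⟩ := x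
        obtain ⟨j, t⟩ := y
        cases s <;> cases t <;> simp_all [letterInv]
      have := htr x y h₂
      rw [hocc] at this
      omega
  refine ⟨hocc, fun x y ↦ ?_⟩
  by_cases hxy : y = x
  · subst hxy
    have h₁ := sum_turns C y
    rw [hocc, ← sum_turns D y, ← Finset.add_sum_erase _ _ (Finset.mem_univ y),
      ← Finset.add_sum_erase _ (turns D y) (Finset.mem_univ y),
      Finset.sum_congr rfl fun z hz ↦ hne y z (Finset.ne_of_mem_erase hz)] at h₁
    exact Nat.add_right_cancel h₁
  · exact hne x y hxy

end Counting

section WordCode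

variable {β : Type*}

lemma toWord_mk_of_norm_eq [DecidableEq β] {L : List (β × Bool)} (h : (mk L).norm = L.length) :
    (mk L).toWord = L := by
  rw [toWord_mk]
  exact (reduce.red (L := L)).sublist.eq_of_length (by rwa [norm, toWord_mk] at h)

lemma eq_mk_take_mul_inv [DecidableEq β] {u : FreeGroup β} {n : ℕ} (h : u.norm = 2 * n) :
    u = mk (u.toWord.take n) * (mk (u⁻¹.toWord.take n))⁻¹ := by
  have hdrop : (u.toWord.drop n).length = n := by
    rw [List.length_drop]
    change u.norm - n = n
    omega
  have hinv : u⁻¹.toWord.take n = invRev (u.toWord.drop n) := by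
    rw [toWord_inv]
    conv_lhs => rw [← List.take_append_drop n u.toWord, invRev_append]
    exact List.take_left' (by simpa using hdrop)
  rw [hinv, ← inv_mk, inv_inv, mul_mk, List.take_append_drop, mk_toWord]

variable [Fintype β]

/-- A numerical code of a word, with the first letter as least significant digit. -/
noncomputable def wordCode (L : List (β × Bool)) : ℕ :=
  Nat.ofDigits (Fintype.card (β × Bool) + 2) (L.map fun y ↦ (Fintype.equivFin (β × Bool) y : ℕ))

lemma wordCode_append (P S : List (β × Bool)) :
    wordCode (P ++ S) = wordCode P + (Fintype.card (β × Bool) + 2) ^ P.length * wordCode S := by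
  simp [wordCode, Nat.ofDigits_append]

lemma eq_of_wordCode_eq {P Q : List (β × Bool)} (hlen : P.length = Q.length)
    (h : wordCode P = wordCode Q) : P = Q := by
  have hdigit : ∀ L : List (β × Bool),
      ∀ d ∈ L.map (fun y ↦ (Fintype.equivFin (β × Bool) y : ℕ)),
        d < Fintype.card (β × Bool) + 2 := by
    intro L d hd
    obtain ⟨y, -, rfl⟩ := List.mem_map.1 hd
    exact (Fin.is_lt _).trans (by omega)
  have hinj : Function.Injective fun y : β × Bool ↦ (Fintype.equivFin (β × Bool) y : ℕ) :=
    Fin.val_injective.comp (Fintype.equivFin _).injective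
  exact hinj.list_map (Nat.ofDigits_inj_of_len_eq (by omega) (by simpa using hlen)
    (hdigit P) (hdigit Q) h)

variable [DecidableEq β]

/-- The code of the first half of the reduced word of `u`. -/
noncomputable def halfCode (u : FreeGroup β) : ℕ :=
  wordCode (u.toWord.take ((u.norm + 1) / 2))

/-- The sum of the codes of the first halves of the reduced words of `u` and `u⁻¹`. -/
noncomputable def codeSum (u : FreeGroup β) : ℕ := halfCode u + halfCode u⁻¹

lemma codeSum_inv (u : FreeGroup β) : codeSum u⁻¹ = codeSum u := by
  rw [codeSum, codeSum, inv_inv, add_comm]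

/-- If exactly half of `u` cancels in `u * v`, multiplying `v` by `u` on the left replaces the
second half of `u⁻¹` by the first half of `u` at the start of `v`. -/
lemma codeSum_mul_lt {u v : FreeGroup β} {n : ℕ} (hu : u.norm = 2 * n) (huv : overlap u⁻¹ v = n)
    (hv : u.norm ≤ v.norm) (hlt : wordCode (u.toWord.take n) < wordCode (u⁻¹.toWord.take n)) :
    codeSum (u * v) < codeSum v := by
  have hnorm : (u * v).norm = v.norm := by
    have := norm_mul u v
    omega
  obtain ⟨R, hR⟩ : ∃ R, v.toWord = u⁻¹.toWord.take n ++ R := by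
    refine ⟨v.toWord.drop n, ?_⟩
    have := take_prefixLen u⁻¹.toWord v.toWord
    rw [show prefixLen u⁻¹.toWord v.toWord = n from huv] at this
    rw [this, List.take_append_drop]
  have hP : (u.toWord.take n).length = n := by
    rw [List.length_take]
    change min n u.norm = n
    omega
  have hQ : (u⁻¹.toWord.take n).length = n := by
    rw [List.length_take]
    change min n u⁻¹.norm = n
    rw [norm_inv_eq]
    omega
  have hu' := eq_mk_take_mul_inv hu
  generalize u.toWord.take n = P at *
  generalize u⁻¹.toWord.take n = Q at *
  have hlen : v.norm = n + R.length := by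
    rw [norm, hR, List.length_append, hQ]
  have hmul : u * v = mk (P ++ R) := by
    rw [hu', ← mk_toWord (x := v), hR, ← mul_mk, ← mul_mk, mul_assoc, inv_mul_cancel_left]
  have hword : (u * v).toWord = P ++ R := by
    rw [hmul] at hnorm ⊢
    exact toWord_mk_of_norm_eq (by rw [hnorm, hlen, List.length_append, hP])
  have hhalf : ∀ S : List (β × Bool), S.length = n →
      (S ++ R).take ((v.norm + 1) / 2) = S ++ R.take ((v.norm + 1) / 2 - n) := by
    intro S hS
    rw [List.take_append, hS, List.take_of_length_le (by omega)]
  have hhalf' : ∀ S : List (β × Bool),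
      (invRev (S ++ R)).take ((v.norm + 1) / 2) = (invRev R).take ((v.norm + 1) / 2) := by
    intro S
    rw [invRev_append, List.take_append_of_le_length (by rw [invRev_length]; omega)]
  simp only [codeSum, halfCode, norm_inv_eq, toWord_inv, hnorm]
  rw [hword, hR, hhalf P hP, hhalf Q hQ, hhalf', hhalf', wordCode_append, wordCode_append, hP, hQ]
  omega

end WordCode

section NielsenReduction

variable {α β : Type*} [Fintype α] [DecidableEq α]

lemma sum_comp_transvectionHom (f : FreeGroup α →* FreeGroup β) {p b : α × Bool}
    {W : FreeGroup β → ℕ} (hW : ∀ u, W u⁻¹ = W u) :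
    ∑ i, W (f.comp (transvectionHom p b) (of i)) + W (f (mk [p])) =
      ∑ i, W (f (of i)) + W (f (mk [p]) * f (mk [b])) := by
  have hletter : ∀ e : FreeGroup α →* FreeGroup β, W (e (of p.1)) = W (e (mk [p])) := by
    intro e
    rw [mk_singleton_eq]
    split_ifs
    · rfl
    · rw [_root_.map_inv, hW]
  rw [← Finset.add_sum_erase _ _ (Finset.mem_univ p.1),
    ← Finset.add_sum_erase _ (fun i ↦ W (f (of i))) (Finset.mem_univ p.1), hletter, hletter,
    MonoidHom.comp_apply, transvectionHom_mk_self, _root_.map_mul,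
    Finset.sum_congr rfl fun i hi ↦ by
      rw [MonoidHom.comp_apply, transvectionHom_of_ne p b (Finset.ne_of_mem_erase hi)]]
  ring

variable [Fintype β] [DecidableEq β]

/-- The complexity of a homomorphism which Nielsen reduction decreases. -/
noncomputable def nielsenSize (f : FreeGroup α →* FreeGroup β) : ℕ ×ₗ ℕ :=
  toLex (∑ i, (f (of i)).norm, ∑ i, codeSum (f (of i)))

variable {f : FreeGroup α →* FreeGroup β}

lemma norm_le_and_codeSum_le
    (hf : ∀ p b : α × Bool, b.1 ≠ p.1 →
      ¬ nielsenSize (f.comp (transvectionHom p b)) < nielsenSize f)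
    {v w : α × Bool} (h : v.1 ≠ w.1) :
    (f (mk [w])).norm ≤ (f (mk [v]) * f (mk [w])).norm ∧
      ((f (mk [v]) * f (mk [w])).norm = (f (mk [w])).norm →
        codeSum (f (mk [w])) ≤ codeSum (f (mk [v]) * f (mk [w]))) := by
  have hmin := hf (letterInv w) (letterInv v) h
  have h₁ := sum_comp_transvectionHom f (p := letterInv w) (b := letterInv v)
    (W := norm) fun u ↦ norm_inv_eq
  have h₂ := sum_comp_transvectionHom f (p := letterInv w) (b := letterInv v)
    (W := codeSum) codeSum_inv
  rw [mk_letterInv, mk_letterInv, _root_.map_inv, _root_.map_inv, ← mul_inv_rev] at h₁ h₂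
  rw [norm_inv_eq, norm_inv_eq] at h₁
  rw [codeSum_inv, codeSum_inv] at h₂
  rw [nielsenSize, nielsenSize, Prod.Lex.toLex_lt_toLex] at hmin
  simp only at hmin
  omega

lemma two_mul_cancellation_le (hinj : Function.Injective f)
    (hf : ∀ p b : α × Bool, b.1 ≠ p.1 →
      ¬ nielsenSize (f.comp (transvectionHom p b)) < nielsenSize f)
    {v w : α × Bool} (h : w ≠ letterInv v) :
    2 * cancellation f v w ≤ (f (mk [v])).norm ∧
      (2 * cancellation f v w = (f (mk [v])).norm → v.1 ≠ w.1 ∧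
        (f (mk [v])).norm ≤ (f (mk [w])).norm) := by
  by_cases hvw : v.1 = w.1
  · obtain rfl : v = w := by
      obtain ⟨i, s⟩ := v
      obtain ⟨j, t⟩ := w
      cases s <;> cases t <;> simp_all [letterInv]
    have hne : f (mk [v]) ≠ 1 := by
      rw [Ne, map_eq_one_iff f hinj, mk_singleton_eq]
      split_ifs <;> simp
    have : 2 * cancellation f v v < (f (mk [v])).norm := two_mul_overlap_inv_self_lt hne
    exact ⟨this.le, fun e ↦ absurd e this.ne⟩
  · have h₁ := (norm_le_and_codeSum_le hf hvw).1
    have h₂ := (norm_le_and_codeSum_le hf (v := letterInv w) (w := letterInv v)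
      (Ne.symm hvw)).1
    rw [mk_letterInv, mk_letterInv, _root_.map_inv, _root_.map_inv, ← mul_inv_rev, norm_inv_eq,
      norm_inv_eq] at h₂
    have h₃ := norm_mul (f (mk [v])) (f (mk [w]))
    change _ + 2 * cancellation f v w = _ at h₃
    exact ⟨by omega, fun e ↦ ⟨hvw, by omega⟩⟩

lemma isNielsenReduced_of_forall_transvectionHom (hinj : Function.Injective f)
    (hf : ∀ p b : α × Bool, b.1 ≠ p.1 →
      ¬ nielsenSize (f.comp (transvectionHom p b)) < nielsenSize f) :
    IsNielsenReduced f := by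
  intro x y z hxy hyz
  by_contra hlt
  have hyx : letterInv x ≠ letterInv (letterInv y) := fun e ↦ hxy (by simpa using e.symm)
  obtain ⟨hx, hx'⟩ := two_mul_cancellation_le hinj hf hyx
  obtain ⟨hz, hz'⟩ := two_mul_cancellation_le hinj hf hyz
  rw [cancellation_letterInv, mk_letterInv, mk_letterInv, _root_.map_inv, _root_.map_inv,
    norm_inv_eq, norm_inv_eq] at hx'
  rw [cancellation_letterInv, mk_letterInv, _root_.map_inv, norm_inv_eq] at hx
  have hcx : 2 * cancellation f x y = (f (mk [y])).norm := by omega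
  have hcz : 2 * cancellation f y z = (f (mk [y])).norm := by omega
  obtain ⟨hnx, hlx⟩ := hx' hcx
  obtain ⟨hnz, hlz⟩ := hz' hcz
  have hcxz : cancellation f x y = cancellation f y z := by omega
  generalize hn : cancellation f y z = n at *
  have hmx := norm_mul (f (mk [y]))⁻¹ (f (mk [x]))⁻¹
  rw [inv_inv, overlap_comm] at hmx
  change _ + 2 * cancellation f x y = _ at hmx
  have hmz := norm_mul (f (mk [y])) (f (mk [z]))
  change _ + 2 * cancellation f y z = _ at hmz
  have hcx' := (norm_le_and_codeSum_le hf hnx).2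
  have hcz' := (norm_le_and_codeSum_le hf hnz).2
  rw [mk_letterInv, mk_letterInv, _root_.map_inv, _root_.map_inv] at hcx'
  rw [norm_inv_eq] at hmx hcx'
  rw [norm_inv_eq] at hmx
  have hle := hcx' (by omega)
  have hle' := hcz' (by omega)
  rcases lt_trichotomy (wordCode ((f (mk [y])).toWord.take n))
    (wordCode ((f (mk [y]))⁻¹.toWord.take n)) with h | h | h
  · exact hle'.not_gt (codeSum_mul_lt hcz.symm hn hlz h)
  · have hlen : ((f (mk [y])).toWord.take n).length = ((f (mk [y]))⁻¹.toWord.take n).length := by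
      rw [List.length_take, List.length_take]
      change min n (f (mk [y])).norm = min n (f (mk [y]))⁻¹.norm
      rw [norm_inv_eq]
    have h₁ := eq_mk_take_mul_inv hcz.symm
    rw [eq_of_wordCode_eq hlen h, mul_inv_cancel, map_eq_one_iff f hinj, mk_singleton_eq] at h₁
    split_ifs at h₁ <;> simp at h₁
  · refine hle.not_gt (codeSum_mul_lt (n := n) ?_ ?_ ?_ ?_)
    · rw [norm_inv_eq, hcz]
    · rw [inv_inv, overlap_comm]
      exact hcxz
    · rwa [norm_inv_eq, norm_inv_eq]
    · rwa [inv_inv]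

/-- Nielsen reduction: an injective homomorphism becomes Nielsen reduced after precomposition with
an automorphism. -/
lemma exists_isNielsenReduced_comp (hinj : Function.Injective f) :
    ∃ φ : FreeGroup α ≃* FreeGroup α, IsNielsenReduced (f.comp φ.toMonoidHom) := by
  let size : (FreeGroup α ≃* FreeGroup α) → ℕ ×ₗ ℕ := fun φ ↦ nielsenSize (f.comp φ.toMonoidHom)
  refine ⟨Function.argmin size, isNielsenReduced_of_forall_transvectionHom
    (hinj.comp (Function.argmin size).injective) fun p b h ↦ ?_⟩
  exact Function.not_lt_argmin size ((transvection p b h).trans (Function.argmin size))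

end NielsenReduction

lemma cyclLen_map_conj {α β : Type*} [DecidableEq β] (f : FreeGroup α →* FreeGroup β)
    (t x : FreeGroup α) : cyclLen (f (t * x * t⁻¹)) = cyclLen (f x) := by
  rw [f.map_mul, f.map_mul, f.map_inv, cyclLen_conj]

/-- Elements whose cyclically reduced lengths agree under all automorphisms also have images of
equal cyclically reduced length under all injective homomorphisms. -/
theorem cyclLen_map_eq {α β : Type*} [Fintype α] [DecidableEq α] [Fintype β] [DecidableEq β]
    {g h : FreeGroup α} (H : ∀ φ : FreeGroup α ≃* FreeGroup α, cyclLen (φ g) = cyclLen (φ h))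
    {f : FreeGroup α →* FreeGroup β} (hinj : Function.Injective f) :
    cyclLen (f g) = cyclLen (f h) := by
  obtain ⟨φ, hφ⟩ := exists_isNielsenReduced_comp hinj
  obtain ⟨s, C, hs, hC⟩ := exists_conj_mk_isCyclicallyReduced (φ.symm g)
  obtain ⟨t, D, ht, hD⟩ := exists_conj_mk_isCyclicallyReduced (φ.symm h)
  obtain ⟨hocc, hturns⟩ := occurrences_eq_and_turns_eq hC hD fun θ ↦ by
    have hθ := H (φ.symm.trans θ)
    rw [MulEquiv.trans_apply, MulEquiv.trans_apply, hs, ht] at hθ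
    exact (cyclLen_map_conj θ.toMonoidHom s (mk C)).symm.trans
      (hθ.trans (cyclLen_map_conj θ.toMonoidHom t (mk D)))
  have hcomp : ∀ x, f x = f.comp φ.toMonoidHom (φ.symm x) := fun x ↦ by simp
  rw [hcomp, hcomp h, hs, ht, cyclLen_map_conj, cyclLen_map_conj]
  have hC' := hφ.hasLocalCancellation.cyclLen_eq hC
  have hD' := hφ.hasLocalCancellation.cyclLen_eq hD
  rw [sum_pairWeight] at hC' hD'
  simp only [hocc, hturns] at hC'
  exact_mod_cast hC'.trans hD'.symm

end FreeGroup

theorem translation_equivalence_via_injective_endomorphisms {k : ℕ} (hk : 2 ≤ k)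
    (g h : FreeGroup (Fin k)) :
    List.TFAE
      [∀ φ : FreeGroup (Fin k) ≃* FreeGroup (Fin k), cyclLen (φ g) = cyclLen (φ h),
       ∀ ψ : FreeGroup (Fin k) →* FreeGroup (Fin k), Function.Injective ψ →
         cyclLen (ψ g) = cyclLen (ψ h),
       ∀ (m : ℕ) (ψ : FreeGroup (Fin k) →* FreeGroup (Fin m)), Function.Injective ψ →
         cyclLen (ψ g) = cyclLen (ψ h)] := by
  tfae_have 1 → 3 := fun H m ψ hψ ↦ FreeGroup.cyclLen_map_eq H hψ
  tfae_have 3 → 2 := fun H ↦ H k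
  tfae_have 2 → 1 := fun H φ ↦ H φ.toMonoidHom φ.injective
  tfae_finish
end

section
/- Let k be a natural number and let u, v ∈ FreeGroup (Fin k) be character equivalent. Then u and v are translation equivalent: for every automorphism φ of FreeGroup (Fin k), ‖φ u‖ = ‖φ v‖. -/
/-- Character (trace) equivalence: `u` and `v` have equal traces under every
representation into `SL(2, ℂ)`. -/
def CharEquiv {k : ℕ} (u v : FreeGroup (Fin k)) : Prop :=
  ∀ ρ : FreeGroup (Fin k) →* Matrix.SpecialLinearGroup (Fin 2) ℂ,
    Matrix.trace ((ρ u : Matrix (Fin 2) (Fin 2) ℂ)) =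
      Matrix.trace ((ρ v : Matrix (Fin 2) (Fin 2) ℂ))

open Matrix

/-- Every conjugacy class contains a cyclically reduced word of length `cyclLen`. -/
theorem exists_isCyclicallyReduced_length_eq_cyclLen {α : Type*} [DecidableEq α]
    (g : FreeGroup α) :
    ∃ L : List (α × Bool), FreeGroup.IsCyclicallyReduced L ∧ L.length = cyclLen g ∧
      IsConj g (FreeGroup.mk L) := by
  obtain ⟨x, hx⟩ : ∃ x : FreeGroup α, (x * g * x⁻¹).norm = cyclLen g :=
    Nat.sInf_mem (s := {n : ℕ | ∃ x : FreeGroup α, (x * g * x⁻¹).norm = n}) ⟨_, 1, rfl⟩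
  set h := x * g * x⁻¹ with hh
  set r := FreeGroup.reduceCyclically h.toWord
  set c := FreeGroup.mk (FreeGroup.reduceCyclically.conjugator h.toWord)
  have hword := FreeGroup.reduceCyclically.conj_conjugator_reduceCyclically h.toWord
  have hconj : c * FreeGroup.mk r * c⁻¹ = h := by
    simpa [c, r, FreeGroup.inv_mk, FreeGroup.mul_mk, FreeGroup.mk_toWord] using
      congrArg FreeGroup.mk hword
  have hle : r.length ≤ cyclLen g := by
    rw [← hx, FreeGroup.norm, ← hword]
    simp only [List.length_append]
    lia
  have hr : (c⁻¹ * x) * g * (c⁻¹ * x)⁻¹ = FreeGroup.mk r := by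
    rw [show (c⁻¹ * x) * g * (c⁻¹ * x)⁻¹ = c⁻¹ * h * c by rw [hh]; group, ← hconj]
    group
  refine ⟨r, FreeGroup.reduceCyclically.isCyclicallyReduced FreeGroup.isReduced_toWord,
    le_antisymm hle ?_, isConj_iff.2 ⟨_, hr⟩⟩
  calc cyclLen g ≤ (FreeGroup.mk r).norm := Nat.sInf_le ⟨c⁻¹ * x, by rw [hr]⟩
    _ ≤ r.length := FreeGroup.norm_mk_le

/-- The attracting fixed point in `ℂ` assigned to a letter; inverse letters get opposite values. -/
def letterPoint {k : ℕ} (x : Fin k × Bool) : ℂ :=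
  if x.2 then (x.1 : ℂ) + 1 else -((x.1 : ℂ) + 1)

theorem letterPoint_ne_zero {k : ℕ} (x : Fin k × Bool) : letterPoint x ≠ 0 := by
  have : ((x.1 : ℕ) : ℂ) + 1 ≠ 0 := Nat.cast_add_one_ne_zero _
  unfold letterPoint
  split_ifs
  · exact this
  · exact neg_ne_zero.2 this

theorem letterPoint_add_ne_zero {k : ℕ} {x y : Fin k × Bool} (h : x.1 = y.1 → x.2 = y.2) :
    letterPoint x + letterPoint y ≠ 0 := by
  obtain ⟨i, b⟩ := x
  obtain ⟨j, c⟩ := y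
  have hs : ((i : ℕ) : ℂ) + 1 + ((j : ℕ) + 1) ≠ 0 := by
    exact_mod_cast (by lia : (i : ℕ) + 1 + (j + 1) ≠ 0)
  have hd : b ≠ c → ((i : ℕ) : ℂ) ≠ (j : ℕ) := fun hbc hij =>
    hbc (h (Fin.ext (Nat.cast_injective hij)))
  cases b <;> cases c <;> simp only [letterPoint, Bool.false_eq_true, if_true, if_false] <;>
    intro h0
  · exact hs (by linear_combination -h0)
  · exact hd (by simp) (by linear_combination -h0)
  · exact hd (by simp) (by linear_combination h0)
  · exact hs (by linear_combination h0)

/-- The matrix with eigenvalues `1` and `t ^ 2` and eigenvectors `(1, z)` and `(1, -z)`. -/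
noncomputable def dilation (z t : ℂ) : Matrix (Fin 2) (Fin 2) ℂ :=
  !![(1 + t ^ 2) / 2, (1 - t ^ 2) / (2 * z); (1 - t ^ 2) * z / 2, (1 + t ^ 2) / 2]

theorem continuous_dilation (z : ℂ) : Continuous (dilation z) := by
  refine continuous_matrix fun i j => ?_
  fin_cases i <;> fin_cases j <;> simp only [dilation] <;> simp <;> fun_prop

theorem det_dilation {z : ℂ} (hz : z ≠ 0) (t : ℂ) : (dilation z t).det = t ^ 2 := by
  rw [dilation, det_fin_two_of]
  field_simp
  ring

theorem adjugate_dilation (z t : ℂ) : (dilation z t).adjugate = dilation (-z) t := by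
  rw [dilation, adjugate_fin_two_of, dilation]
  ext i j
  fin_cases i <;> fin_cases j <;> simp [div_neg]
  ring

/-- The product of the dilations along a word. -/
noncomputable def wordDilation {k : ℕ} (L : List (Fin k × Bool)) (t : ℂ) :
    Matrix (Fin 2) (Fin 2) ℂ :=
  (L.map fun x => dilation (letterPoint x) t).prod

theorem continuous_wordDilation {k : ℕ} (L : List (Fin k × Bool)) :
    Continuous (wordDilation L) :=
  continuous_list_prod L fun _ _ => continuous_dilation _

/-- On reduced words the limiting product has rank one, with nonzero entries. -/
theorem wordDilation_zero_of_isReduced {k : ℕ} (x : Fin k × Bool) (L : List (Fin k × Bool))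
    (h : FreeGroup.IsReduced (x :: L)) :
    ∃ c : ℂ, c ≠ 0 ∧ ∃ y ∈ (x :: L).getLast?, wordDilation (x :: L) 0 =
      c • !![1, 1 / letterPoint y; letterPoint x, letterPoint x / letterPoint y] := by
  induction L generalizing x with
  | nil =>
    refine ⟨1 / 2, by norm_num, x, rfl, ?_⟩
    have := letterPoint_ne_zero x
    ext i j
    fin_cases i <;> fin_cases j <;> simp [wordDilation, dilation, this] <;>
      field_simp
  | cons w L ih =>
    rw [FreeGroup.IsReduced, List.isChain_cons_cons] at h
    obtain ⟨c, hc, y, hy, hprod⟩ := ih w h.2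
    have hx := letterPoint_ne_zero x
    have hy' := letterPoint_ne_zero y
    refine ⟨c * (letterPoint x + letterPoint w) / (2 * letterPoint x),
      div_ne_zero (mul_ne_zero hc (letterPoint_add_ne_zero h.1)) (by simpa), y,
      by simpa using hy, ?_⟩
    rw [wordDilation, List.map_cons, List.prod_cons, ← wordDilation, hprod]
    ext i j
    fin_cases i <;> fin_cases j <;>
      simp [dilation, mul_apply, Fin.sum_univ_two] <;> field_simp

theorem trace_wordDilation_zero_ne_zero {k : ℕ} {L : List (Fin k × Bool)}
    (h : FreeGroup.IsCyclicallyReduced L) : (wordDilation L 0).trace ≠ 0 := by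
  cases L with
  | nil => simp [wordDilation]
  | cons x L =>
    obtain ⟨c, hc, y, hy, hprod⟩ := wordDilation_zero_of_isReduced x L h.1
    have hyx := letterPoint_add_ne_zero (h.2 y hy x rfl)
    have hy' := letterPoint_ne_zero y
    have : (wordDilation (x :: L) 0).trace =
        c * ((letterPoint y + letterPoint x) / letterPoint y) := by
      rw [hprod, trace_smul, trace_fin_two_of, smul_eq_mul]
      field_simp
    rw [this]
    exact mul_ne_zero hc (div_ne_zero hyx hy')

/-- A dilation normalized to determinant one. -/
noncomputable def dilationSL {z t : ℂ} (hz : z ≠ 0) (ht : t ≠ 0) :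
    Matrix.SpecialLinearGroup (Fin 2) ℂ :=
  ⟨t⁻¹ • dilation z t, by
    rw [det_smul, det_dilation hz, Fintype.card_fin, ← mul_pow, inv_mul_cancel₀ ht, one_pow]⟩

theorem coe_dilationSL {z t : ℂ} (hz : z ≠ 0) (ht : t ≠ 0) :
    (dilationSL hz ht : Matrix (Fin 2) (Fin 2) ℂ) = t⁻¹ • dilation z t :=
  rfl

/-- The representation sending each generator to its normalized dilation. -/
noncomputable def dilationRep (k : ℕ) {t : ℂ} (ht : t ≠ 0) :
    FreeGroup (Fin k) →* Matrix.SpecialLinearGroup (Fin 2) ℂ :=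
  FreeGroup.lift fun i => dilationSL (letterPoint_ne_zero (i, true)) ht

theorem dilationRep_mk {k : ℕ} {t : ℂ} (ht : t ≠ 0) (L : List (Fin k × Bool)) :
    (dilationRep k ht (FreeGroup.mk L) : Matrix (Fin 2) (Fin 2) ℂ) =
      t⁻¹ ^ L.length • wordDilation L t := by
  rw [dilationRep, FreeGroup.lift_mk]
  induction L with
  | nil => simp [wordDilation]
  | cons x L ih =>
    rw [List.map_cons, List.prod_cons, Matrix.SpecialLinearGroup.coe_mul, ih, List.length_cons,
      pow_succ', wordDilation, wordDilation, List.map_cons, List.prod_cons, ← smul_mul_smul_comm]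
    congr 1
    obtain ⟨i, b⟩ := x
    cases b
    · simp [Matrix.SpecialLinearGroup.coe_inv, coe_dilationSL, adjugate_smul, adjugate_dilation,
        letterPoint]
    · rfl

theorem trace_dilationRep {k : ℕ} {t : ℂ} (ht : t ≠ 0) {g : FreeGroup (Fin k)}
    {L : List (Fin k × Bool)} (h : IsConj g (FreeGroup.mk L)) :
    (dilationRep k ht g : Matrix (Fin 2) (Fin 2) ℂ).trace =
      t⁻¹ ^ L.length * (wordDilation L t).trace := by
  obtain ⟨c, hc⟩ := isConj_iff.1 h
  rw [← smul_eq_mul, ← trace_smul, ← dilationRep_mk ht, ← hc, map_mul, map_mul, map_inv]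
  generalize dilationRep k ht c = C
  generalize dilationRep k ht g = G
  calc G.val.trace = (C⁻¹ * (C * G)).val.trace := by rw [inv_mul_cancel_left]
    _ = (C * G * C⁻¹).val.trace := trace_mul_comm (C⁻¹).val (C * G).val

theorem CharEquiv.symm {k : ℕ} {u v : FreeGroup (Fin k)} (h : CharEquiv u v) : CharEquiv v u :=
  fun ρ => (h ρ).symm

theorem CharEquiv.map {k : ℕ} {u v : FreeGroup (Fin k)} (h : CharEquiv u v)
    (φ : FreeGroup (Fin k) →* FreeGroup (Fin k)) : CharEquiv (φ u) (φ v) :=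
  fun ρ => h (ρ.comp φ)

theorem CharEquiv.cyclLen_le {k : ℕ} {u v : FreeGroup (Fin k)} (h : CharEquiv u v) :
    cyclLen v ≤ cyclLen u := by
  obtain ⟨L, -, hLlen, hLconj⟩ := exists_isCyclicallyReduced_length_eq_cyclLen u
  obtain ⟨M, hM, hMlen, hMconj⟩ := exists_isCyclicallyReduced_length_eq_cyclLen v
  rw [← hLlen, ← hMlen]
  by_contra! hlt
  obtain ⟨d, hd⟩ := Nat.exists_eq_add_of_lt hlt
  have heq : ∀ t : ℂ, t ≠ 0 →
      (wordDilation M t).trace = t ^ (d + 1) * (wordDilation L t).trace := by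
    intro t ht
    have htr := h (dilationRep k ht)
    rw [trace_dilationRep ht hLconj, trace_dilationRep ht hMconj, hd] at htr
    simp only [inv_pow] at htr
    field_simp at htr
    have htL : t ^ L.length ≠ 0 := pow_ne_zero _ ht
    apply mul_left_cancel₀ htL
    rw [← htr]
    ring
  have hfun : (fun t => (wordDilation M t).trace) =
      fun t => t ^ (d + 1) * (wordDilation L t).trace :=
    Continuous.ext_on (dense_compl_singleton (0 : ℂ)) (continuous_wordDilation M).matrix_trace
      ((continuous_pow _).mul (continuous_wordDilation L).matrix_trace) heq
  exact trace_wordDilation_zero_ne_zero hM (by simpa using congrFun hfun 0)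

theorem character_equivalence_implies_translation_equivalence {k : ℕ}
    (u v : FreeGroup (Fin k)) (huv : CharEquiv u v) :
    ∀ φ : FreeGroup (Fin k) ≃* FreeGroup (Fin k), cyclLen (φ u) = cyclLen (φ v) := by
  exact fun φ => le_antisymm (huv.symm.map φ.toMonoidHom).cyclLen_le
    (huv.map φ.toMonoidHom).cyclLen_le
end

section
/- Let k ≥ 2, let w ∈ FreeGroup (Fin 2), and let g, h ∈ FreeGroup (Fin k). Then w(g,h) and w^R(g,h) are translation equivalent in FreeGroup (Fin k): for every automorphism φ of FreeGroup (Fin k), ‖φ (w(g,h))‖ = ‖φ (w^R(g,h))‖. -/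
/-- The palindromic reverse `w^R = (σ w)⁻¹` of a word `w ∈ F(x,y)`, where `σ` sends each
generator to its inverse: the word `w` read backwards without inverting its letters. -/
def palRev (w : FreeGroup (Fin 2)) : FreeGroup (Fin 2) :=
  (FreeGroup.lift (fun i : Fin 2 => (FreeGroup.of i)⁻¹) w)⁻¹

namespace PalindromicReverse

open Matrix
open scoped MatrixGroups

/-! ### Traces of a word and of its palindromic reverse in `SL₂` -/

section Trace

variable {R : Type*} [CommRing R]

/-- The pair `(X, Y)` lies in the span of `(1, 1)`, `(A, A)`, `(B, B)` and `(A * B, B * A)`. -/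
def ReversePair (A B X Y : Matrix (Fin 2) (Fin 2) R) : Prop :=
  ∃ p q r s : R, X = p • 1 + q • A + r • B + s • (A * B) ∧
    Y = p • 1 + q • A + r • B + s • (B * A)

theorem sq_eq_trace_smul_sub_one {A : Matrix (Fin 2) (Fin 2) R} (hA : A.det = 1) :
    A * A = A.trace • A - 1 := by
  rw [det_fin_two] at hA
  ext i j
  fin_cases i <;> fin_cases j <;> simp [mul_apply, trace_fin_two] <;>
    first | ring1 | linear_combination -hA

theorem fin_two_mul_comm_eq (A B : Matrix (Fin 2) (Fin 2) R) :
    B * A = A.trace • B + B.trace • A + ((A * B).trace - A.trace * B.trace) • 1 - A * B := by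
  ext i j
  fin_cases i <;> fin_cases j <;> simp [mul_apply, trace_fin_two, Fin.sum_univ_two] <;> ring

variable {A B X Y X' Y' : Matrix (Fin 2) (Fin 2) R}

theorem ReversePair.one : ReversePair A B 1 1 := ⟨1, 0, 0, 0, by simp, by simp⟩

theorem ReversePair.trace_eq (h : ReversePair A B X Y) : X.trace = Y.trace := by
  obtain ⟨p, q, r, s, rfl, rfl⟩ := h
  simp [trace_mul_comm A B]

theorem ReversePair.smul_sub (c : R) (h : ReversePair A B X Y) (h' : ReversePair A B X' Y') :
    ReversePair A B (c • X - X') (c • Y - Y') := by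
  obtain ⟨p, q, r, s, rfl, rfl⟩ := h
  obtain ⟨p', q', r', s', rfl, rfl⟩ := h'
  exact ⟨c * p - p', c * q - q', c * r - r', c * s - s', by module, by module⟩

theorem ReversePair.symm (h : ReversePair A B X Y) : ReversePair B A X Y := by
  obtain ⟨p, q, r, s, rfl, rfl⟩ := h
  refine ⟨p + s * ((A * B).trace - A.trace * B.trace), r + s * A.trace, q + s * B.trace, -s,
    ?_, ?_⟩ <;>
    rw [fin_two_mul_comm_eq A B] <;> module

theorem ReversePair.mul_left (hA : A.det = 1) (h : ReversePair A B X Y) :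
    ReversePair A B (A * X) (Y * A) := by
  obtain ⟨p, q, r, s, rfl, rfl⟩ := h
  have hsq := sq_eq_trace_smul_sub_one hA
  refine ⟨-q, p + A.trace * q, -s, r + A.trace * s, ?_, ?_⟩
  · simp only [mul_add, mul_smul_comm, mul_one, ← mul_assoc, hsq, sub_mul, smul_mul_assoc, one_mul]
    module
  · simp only [add_mul, mul_smul_comm, one_mul, mul_assoc, hsq, mul_sub, smul_mul_assoc, mul_one]
    module

theorem coe_inv_eq_trace_smul_sub (A : SL(2, R)) :
    (↑A⁻¹ : Matrix (Fin 2) (Fin 2) R) = (A : Matrix (Fin 2) (Fin 2) R).trace • 1 - A := by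
  rw [Matrix.SpecialLinearGroup.coe_inv, adjugate_fin_two]
  ext i j
  fin_cases i <;> fin_cases j <;> simp [trace_fin_two]

theorem ReversePair.inv_mul_left {A : SL(2, R)} (h : ReversePair (A : Matrix _ _ R) B X Y) :
    ReversePair (A : Matrix _ _ R) B ((↑A⁻¹ : Matrix (Fin 2) (Fin 2) R) * X)
      (Y * (↑A⁻¹ : Matrix (Fin 2) (Fin 2) R)) := by
  rw [coe_inv_eq_trace_smul_sub]
  simpa [sub_mul, mul_sub] using h.smul_sub _ (h.mul_left A.det_coe)

theorem palRev_of (i : Fin 2) : palRev (FreeGroup.of i) = FreeGroup.of i := by simp [palRev]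

theorem palRev_inv (w : FreeGroup (Fin 2)) : palRev w⁻¹ = (palRev w)⁻¹ := by simp [palRev]

theorem palRev_mul (w z : FreeGroup (Fin 2)) : palRev (w * z) = palRev z * palRev w := by
  simp [palRev]

theorem reversePair_lift_mul (A B : SL(2, R)) (w : FreeGroup (Fin 2)) :
    ∀ X Y, ReversePair (A : Matrix _ _ R) (B : Matrix _ _ R) X Y →
      ReversePair (A : Matrix _ _ R) (B : Matrix _ _ R)
        ((FreeGroup.lift ![A, B] w : Matrix (Fin 2) (Fin 2) R) * X)
        (Y * (FreeGroup.lift ![A, B] (palRev w) : Matrix (Fin 2) (Fin 2) R)) := by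
  induction w using FreeGroup.induction_on with
  | C1 => simp [palRev]
  | of i =>
    intro X Y h
    rw [palRev_of, FreeGroup.lift_apply_of]
    fin_cases i
    · simpa using h.mul_left A.det_coe
    · simpa using (h.symm.mul_left B.det_coe).symm
  | inv_of i _ =>
    intro X Y h
    rw [palRev_inv, palRev_of, _root_.map_inv, FreeGroup.lift_apply_of]
    fin_cases i
    · simpa using h.inv_mul_left
    · simpa using h.symm.inv_mul_left.symm
  | mul w z hw hz =>
    intro X Y h
    simpa [palRev_mul, Matrix.mul_assoc] using hw _ _ (hz _ _ h)

theorem trace_lift_palRev (A B : SL(2, R)) (w : FreeGroup (Fin 2)) :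
    (FreeGroup.lift ![A, B] (palRev w) : Matrix (Fin 2) (Fin 2) R).trace =
      (FreeGroup.lift ![A, B] w : Matrix (Fin 2) (Fin 2) R).trace := by
  simpa using (reversePair_lift_mul A B w 1 1 .one).trace_eq.symm

end Trace

/-! ### Representations of a free group whose traces detect the cyclically reduced length -/

section Schottky

variable {α : Type*} (p : α × Bool → ℝ)

/-- The letter inverse to a given one. -/
def invLetter (x : α × Bool) : α × Bool := (x.1, !x.2)

/-- The vector spanning the line attracting for the letter `x`. -/
def attrVec (x : α × Bool) : Fin 2 → ℝ := ![1, p x]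

/-- The linear form that kills the line repelling for the letter `x` and takes the value `1` at
`attrVec p x`. -/
noncomputable def repForm (x : α × Bool) : Fin 2 → ℝ :=
  (p x - p (invLetter x))⁻¹ • ![-p (invLetter x), 1]

/-- The projection onto the attracting line of the letter `x` along its repelling line. -/
noncomputable def attrProj (x : α × Bool) : Matrix (Fin 2) (Fin 2) ℝ :=
  vecMulVec (attrVec p x) (repForm p x)

variable {p}

theorem sub_invLetter_ne_zero (hp : p.Injective) (x : α × Bool) : p x - p (invLetter x) ≠ 0 := by
  refine sub_ne_zero.2 fun h ↦ ?_
  simpa [invLetter] using congrArg Prod.snd (hp h)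

theorem repForm_dotProduct_attrVec_ne_zero (hp : p.Injective) {x y : α × Bool}
    (h : x.1 = y.1 → x.2 = y.2) : repForm p x ⬝ᵥ attrVec p y ≠ 0 := by
  have hy : p y - p (invLetter x) ≠ 0 := by
    refine sub_ne_zero.2 fun e ↦ ?_
    obtain rfl := hp e
    simp [invLetter] at h
  have : repForm p x ⬝ᵥ attrVec p y = (p x - p (invLetter x))⁻¹ * (p y - p (invLetter x)) := by
    simp [repForm, attrVec, dotProduct, Fin.sum_univ_two]
    ring
  rw [this]
  exact mul_ne_zero (inv_ne_zero (sub_invLetter_ne_zero hp x)) hy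

theorem prod_map_attrProj (hp : p.Injective) (L : List (α × Bool)) :
    ∀ x, FreeGroup.IsReduced (x :: L) → ∃ c : ℝ, c ≠ 0 ∧
      ((x :: L).map (attrProj p)).prod =
        c • vecMulVec (attrVec p x) (repForm p ((x :: L).getLast (by simp))) := by
  induction L with
  | nil => exact fun x _ ↦ ⟨1, one_ne_zero, by simp [attrProj]⟩
  | cons y L ih =>
    intro x h
    rw [FreeGroup.isReduced_cons_cons] at h
    obtain ⟨c, hc, e⟩ := ih y h.2
    refine ⟨c * (repForm p x ⬝ᵥ attrVec p y),
      mul_ne_zero hc (repForm_dotProduct_attrVec_ne_zero hp h.1), ?_⟩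
    rw [List.map_cons, List.prod_cons, e, attrProj, mul_smul_comm, vecMulVec_mul_vecMulVec]
    simp [mul_smul]

theorem trace_prod_map_attrProj_ne_zero (hp : p.Injective) {L : List (α × Bool)}
    (h : FreeGroup.IsCyclicallyReduced L) : (L.map (attrProj p)).prod.trace ≠ 0 := by
  cases L with
  | nil => simp
  | cons x L =>
    obtain ⟨c, hc, e⟩ := prod_map_attrProj hp L x h.isReduced
    rw [e, trace_smul, trace_vecMulVec, dotProduct_comm]
    exact mul_ne_zero hc (repForm_dotProduct_attrVec_ne_zero hp
      (h.2 _ (List.getLast_mem_getLast? _) _ (by simp)))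

variable (p) in
/-- The hyperbolic matrix with eigenvalue `t⁻¹` on the attracting line of `x` and `t` on its
repelling line. -/
noncomputable def hypMatrix (t : ℝ) (x : α × Bool) : Matrix (Fin 2) (Fin 2) ℝ :=
  t⁻¹ • attrProj p x + t • attrProj p (invLetter x)

theorem det_hypMatrix (hp : p.Injective) {t : ℝ} (ht : t ≠ 0) (x : α × Bool) :
    (hypMatrix p t x).det = 1 := by
  have h₁ := sub_invLetter_ne_zero hp x
  have h₂ : p (invLetter x) - p x ≠ 0 := by rwa [← neg_sub, neg_ne_zero]
  have h₃ : invLetter (invLetter x) = x := by simp [invLetter]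
  simp [hypMatrix, attrProj, attrVec, repForm, det_fin_two, h₃]
  field_simp
  ring

theorem adjugate_hypMatrix (hp : p.Injective) (t : ℝ) (x : α × Bool) :
    (hypMatrix p t x).adjugate = hypMatrix p t (invLetter x) := by
  have h₁ := sub_invLetter_ne_zero hp x
  have h₂ : p (invLetter x) - p x ≠ 0 := by rwa [← neg_sub, neg_ne_zero]
  have h₃ : invLetter (invLetter x) = x := by simp [invLetter]
  rw [adjugate_fin_two]
  ext i j
  fin_cases i <;> fin_cases j <;>
    simp [hypMatrix, attrProj, attrVec, repForm, h₃] <;> field_simp <;> ring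

/-- `hypMatrix p t x` as an element of `SL(2, ℝ)`. -/
noncomputable def hypSL (hp : p.Injective) {t : ℝ} (ht : t ≠ 0) (x : α × Bool) : SL(2, ℝ) :=
  ⟨hypMatrix p t x, det_hypMatrix hp ht x⟩

theorem coe_hypSL (hp : p.Injective) {t : ℝ} (ht : t ≠ 0) (x : α × Bool) :
    (hypSL hp ht x : Matrix (Fin 2) (Fin 2) ℝ) = hypMatrix p t x := rfl

/-- The representation sending each generator `a` to `hypMatrix p t (a, true)`. -/
noncomputable def schottkyRep (hp : p.Injective) {t : ℝ} (ht : t ≠ 0) : FreeGroup α →* SL(2, ℝ) :=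
  FreeGroup.lift fun a ↦ hypSL hp ht (a, true)

theorem schottkyRep_mk (hp : p.Injective) {t : ℝ} (ht : t ≠ 0) (L : List (α × Bool)) :
    (schottkyRep hp ht (FreeGroup.mk L) : Matrix (Fin 2) (Fin 2) ℝ) =
      (L.map (hypMatrix p t)).prod := by
  induction L with
  | nil => simp [schottkyRep, ← FreeGroup.one_eq_mk]
  | cons x L ih =>
    rw [List.map_cons, List.prod_cons, ← ih]
    obtain ⟨a, b⟩ := x
    cases b
    · simp [schottkyRep, FreeGroup.lift_mk, coe_hypSL, adjugate_hypMatrix hp, invLetter]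
    · simp [schottkyRep, FreeGroup.lift_mk, coe_hypSL]

variable (p) in
/-- The rescaling of the trace of the image of a word under `schottkyRep` which extends
continuously to `t = 0`. -/
noncomputable def scaledTrace (L : List (α × Bool)) (t : ℝ) : ℝ :=
  (L.map fun x ↦ attrProj p x + t ^ 2 • attrProj p (invLetter x)).prod.trace

theorem continuous_scaledTrace (L : List (α × Bool)) : Continuous (scaledTrace p L) := by
  refine Continuous.matrix_trace ?_
  induction L with
  | nil => simpa using continuous_const
  | cons x L ih =>
    simp only [List.map_cons, List.prod_cons]
    exact Continuous.matrix_mul (by fun_prop) ih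

theorem scaledTrace_zero (L : List (α × Bool)) :
    scaledTrace p L 0 = (L.map (attrProj p)).prod.trace := by
  simp [scaledTrace]

theorem scaledTrace_eq (hp : p.Injective) {t : ℝ} (ht : t ≠ 0) (L : List (α × Bool)) :
    scaledTrace p L t =
      t ^ L.length * (schottkyRep hp ht (FreeGroup.mk L) : Matrix (Fin 2) (Fin 2) ℝ).trace := by
  have hx (x : α × Bool) :
      attrProj p x + t ^ 2 • attrProj p (invLetter x) = t • hypMatrix p t x := by
    simp [hypMatrix, smul_smul, ht, pow_two]
  rw [schottkyRep_mk, scaledTrace, ← smul_eq_mul, ← trace_smul]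
  simp only [hx]
  congr 1
  induction L with
  | nil => simp
  | cons x L ih => simp [ih, smul_smul, pow_succ]

theorem length_le_of_trace_schottkyRep_eq (hp : p.Injective) {L L' : List (α × Bool)}
    (hL : FreeGroup.IsCyclicallyReduced L)
    (h : ∀ t : ℝ, ∀ ht : t ≠ 0,
      (schottkyRep hp ht (FreeGroup.mk L) : Matrix (Fin 2) (Fin 2) ℝ).trace =
        (schottkyRep hp ht (FreeGroup.mk L') : Matrix (Fin 2) (Fin 2) ℝ).trace) :
    L.length ≤ L'.length := by
  by_contra! hlt
  obtain ⟨n, hn⟩ := Nat.exists_eq_add_of_lt hlt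
  have key : ∀ t : ℝ, t ≠ 0 → scaledTrace p L t = t ^ (n + 1) * scaledTrace p L' t := by
    intro t ht
    rw [scaledTrace_eq hp ht, scaledTrace_eq hp ht, h t ht, hn]
    ring
  have heq : scaledTrace p L = fun t ↦ t ^ (n + 1) * scaledTrace p L' t :=
    Continuous.ext_on (dense_compl_singleton (0 : ℝ)) (continuous_scaledTrace L)
      ((continuous_pow _).mul (continuous_scaledTrace L')) key
  apply trace_prod_map_attrProj_ne_zero hp hL
  rw [← scaledTrace_zero, heq]
  simp

end Schottky

theorem exists_isCyclicallyReduced_length_eq_cyclLen {α : Type*} [DecidableEq α]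
    (g : FreeGroup α) : ∃ (x : FreeGroup α) (L : List (α × Bool)),
      x * g * x⁻¹ = FreeGroup.mk L ∧ FreeGroup.IsCyclicallyReduced L ∧
        L.length = cyclLen g := by
  obtain ⟨x, hx⟩ : ∃ x : FreeGroup α, FreeGroup.norm (x * g * x⁻¹) = cyclLen g :=
    Nat.sInf_mem (s := {n | ∃ x : FreeGroup α, FreeGroup.norm (x * g * x⁻¹) = n}) ⟨_, 1, rfl⟩
  set W := (x * g * x⁻¹).toWord with hW
  have hred : FreeGroup.IsReduced W := FreeGroup.isReduced_toWord
  have hcyc := FreeGroup.reduceCyclically.isCyclicallyReduced hred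
  have hdec := FreeGroup.reduceCyclically.conj_conjugator_reduceCyclically W
  set C := FreeGroup.reduceCyclically.conjugator W
  set L := FreeGroup.reduceCyclically W
  have hconj : (FreeGroup.mk C)⁻¹ * x * g * ((FreeGroup.mk C)⁻¹ * x)⁻¹ = FreeGroup.mk L := by
    have : x * g * x⁻¹ = FreeGroup.mk C * FreeGroup.mk L * (FreeGroup.mk C)⁻¹ := by
      rw [FreeGroup.inv_mk, FreeGroup.mul_mk, FreeGroup.mul_mk, hdec, hW, FreeGroup.mk_toWord]
    calc _ = (FreeGroup.mk C)⁻¹ * (x * g * x⁻¹) * FreeGroup.mk C := by group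
      _ = _ := by rw [this]; group
  refine ⟨_, L, hconj, hcyc, le_antisymm ?_ ?_⟩
  · rw [← hx, FreeGroup.norm, ← hW, ← hdec]
    simp only [List.length_append]
    lia
  · refine Nat.sInf_le ⟨(FreeGroup.mk C)⁻¹ * x, ?_⟩
    rw [hconj, FreeGroup.norm, FreeGroup.toWord_mk, hcyc.isReduced.reduce_eq]

theorem trace_map_conj {G R : Type*} [Group G] [CommRing R] (ρ : G →* SL(2, R)) (x g : G) :
    (ρ (x * g * x⁻¹) : Matrix (Fin 2) (Fin 2) R).trace =
      (ρ g : Matrix (Fin 2) (Fin 2) R).trace := by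
  rw [map_mul, Matrix.SpecialLinearGroup.coe_mul, trace_mul_comm,
    ← Matrix.SpecialLinearGroup.coe_mul, ← map_mul]
  simp

theorem cyclLen_le_of_trace_eq {α : Type*} [DecidableEq α] {p : α × Bool → ℝ} (hp : p.Injective)
    {g g' : FreeGroup α}
    (h : ∀ ρ : FreeGroup α →* SL(2, ℝ), (ρ g : Matrix (Fin 2) (Fin 2) ℝ).trace =
      (ρ g' : Matrix (Fin 2) (Fin 2) ℝ).trace) : cyclLen g ≤ cyclLen g' := by
  obtain ⟨x, L, hx, hL, hlen⟩ := exists_isCyclicallyReduced_length_eq_cyclLen g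
  obtain ⟨x', L', hx', -, hlen'⟩ := exists_isCyclicallyReduced_length_eq_cyclLen g'
  rw [← hlen, ← hlen']
  refine length_le_of_trace_schottkyRep_eq hp hL fun t ht ↦ ?_
  rw [← hx, ← hx', trace_map_conj, trace_map_conj, h]

theorem map_lift_pair {G H : Type*} [Group G] [Group H] (f : G →* H) (g h : G)
    (w : FreeGroup (Fin 2)) :
    f (FreeGroup.lift ![g, h] w) = FreeGroup.lift ![f g, f h] w := by
  rw [← MonoidHom.comp_apply]
  congr 1
  ext i
  fin_cases i <;> simp

end PalindromicReverse

theorem palindromic_reverse_translation_equivalent {k : ℕ} (hk : 2 ≤ k)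
    (w : FreeGroup (Fin 2)) (g h : FreeGroup (Fin k)) :
    ∀ φ : FreeGroup (Fin k) ≃* FreeGroup (Fin k),
      cyclLen (φ (FreeGroup.lift ![g, h] w)) =
        cyclLen (φ (FreeGroup.lift ![g, h] (palRev w))) := by
  intro φ
  obtain ⟨f, hf⟩ := Countable.exists_injective_nat (Fin k × Bool)
  have hp : Function.Injective fun x ↦ (f x : ℝ) := Nat.cast_injective.comp hf
  have htr (ρ : FreeGroup (Fin k) →* Matrix.SpecialLinearGroup (Fin 2) ℝ) :
      (ρ (φ (FreeGroup.lift ![g, h] (palRev w))) : Matrix (Fin 2) (Fin 2) ℝ).trace =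
        (ρ (φ (FreeGroup.lift ![g, h] w)) : Matrix (Fin 2) (Fin 2) ℝ).trace := by
    have key := PalindromicReverse.map_lift_pair (ρ.comp φ.toMonoidHom) g h
    simp only [MonoidHom.comp_apply, MulEquiv.coe_toMonoidHom] at key
    rw [key, key, PalindromicReverse.trace_lift_palRev]
  exact le_antisymm (PalindromicReverse.cyclLen_le_of_trace_eq hp fun ρ ↦ (htr ρ).symm)
    (PalindromicReverse.cyclLen_le_of_trace_eq hp htr)
end

section
/- Let k ≥ 2 and let M ≥ 1 be an integer. Then there exist elements g₁, …, g_M of FreeGroup (Fin k) such that for all indices i, j the elements g_i and g_j are translation equivalent, and for i ≠ j the element g_i is conjugate neither to g_j nor to g_j⁻¹. -/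
/-- Translation equivalence (combinatorial form): equal cyclically reduced length
with respect to every free basis. -/
def TransEquiv {k : ℕ} (g h : FreeGroup (Fin k)) : Prop :=
  ∀ φ : FreeGroup (Fin k) ≃* FreeGroup (Fin k), cyclLen (φ g) = cyclLen (φ h)

open Polynomial Matrix

/-- `HasLeadingMatrix n M N` says that the entries of `M` have degree at most `n` and that `N` is
the matrix of their coefficients of degree `n`. -/
def HasLeadingMatrix (n : ℕ) (M : Matrix (Fin 2) (Fin 2) ℤ[X]) (N : Matrix (Fin 2) (Fin 2) ℤ) :
    Prop :=
  ∀ i j, (M i j).natDegree ≤ n ∧ (M i j).coeff n = N i j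

namespace HasLeadingMatrix

theorem one : HasLeadingMatrix 0 1 1 := by
  intro i j
  fin_cases i <;> fin_cases j <;> simp

theorem mul {m n : ℕ} {M M' : Matrix (Fin 2) (Fin 2) ℤ[X]} {N N' : Matrix (Fin 2) (Fin 2) ℤ}
    (h : HasLeadingMatrix m M N) (h' : HasLeadingMatrix n M' N') :
    HasLeadingMatrix (m + n) (M * M') (N * N') := by
  intro i j
  simp only [Matrix.mul_apply, Fin.sum_univ_two]
  refine ⟨natDegree_add_le_of_degree_le ?_ ?_, ?_⟩
  · exact natDegree_mul_le_of_le (h _ _).1 (h' _ _).1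
  · exact natDegree_mul_le_of_le (h _ _).1 (h' _ _).1
  · rw [coeff_add, coeff_mul_add_eq_of_natDegree_le (h _ _).1 (h' _ _).1,
      coeff_mul_add_eq_of_natDegree_le (h _ _).1 (h' _ _).1]
    simp only [(h _ _).2, (h' _ _).2]

theorem of_linear {M : Matrix (Fin 2) (Fin 2) ℤ[X]} {N B : Matrix (Fin 2) (Fin 2) ℤ}
    (h : ∀ i j, M i j = C (N i j) * X + C (B i j)) : HasLeadingMatrix 1 M N := by
  intro i j
  rw [h]
  exact ⟨natDegree_linear_le, by
    rw [coeff_add, coeff_C_mul, coeff_X_one, coeff_C_succ, mul_one, add_zero]⟩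

theorem natDegree_trace_le {n : ℕ} {M : Matrix (Fin 2) (Fin 2) ℤ[X]}
    {N : Matrix (Fin 2) (Fin 2) ℤ} (h : HasLeadingMatrix n M N) : M.trace.natDegree ≤ n := by
  rw [Matrix.trace_fin_two]
  exact natDegree_add_le_of_degree_le (h _ _).1 (h _ _).1

theorem coeff_trace {n : ℕ} {M : Matrix (Fin 2) (Fin 2) ℤ[X]}
    {N : Matrix (Fin 2) (Fin 2) ℤ} (h : HasLeadingMatrix n M N) : M.trace.coeff n = N.trace := by
  rw [Matrix.trace_fin_two, Matrix.trace_fin_two, coeff_add, (h _ _).2, (h _ _).2]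

end HasLeadingMatrix

/-- A matrix of trace `X` whose leading coefficient matrix has image spanned by `(1, m)` and kernel
spanned by `(1, m + 1)`. -/
noncomputable def hyperbolicMatrix (m : ℤ) : Matrix.SpecialLinearGroup (Fin 2) ℤ[X] :=
  ⟨!![C (m + 1) * X + C (2 * m + 1), C (-1) * X + C (-2);
      C (m * (m + 1)) * X + C (m ^ 2 + (m + 1) ^ 2), C (-m) * X + C (-(2 * m + 1))], by
    rw [det_fin_two_of]
    simp only [map_add, map_mul, map_pow, map_one, map_neg, map_ofNat]
    ring⟩

theorem hasLeadingMatrix_hyperbolicMatrix (m : ℤ) :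
    HasLeadingMatrix 1 (hyperbolicMatrix m) (vecMulVec ![1, m] ![m + 1, -1]) := by
  refine .of_linear (B := !![2 * m + 1, -2; m ^ 2 + (m + 1) ^ 2, -(2 * m + 1)]) fun i j => ?_
  fin_cases i <;> fin_cases j <;> simp [hyperbolicMatrix]

theorem hasLeadingMatrix_hyperbolicMatrix_inv (m : ℤ) :
    HasLeadingMatrix 1 (hyperbolicMatrix m)⁻¹.val (vecMulVec ![1, m + 1] ![-m, 1]) := by
  rw [Matrix.SpecialLinearGroup.coe_inv, adjugate_fin_two]
  refine .of_linear (B := !![-(2 * m + 1), 2; -(m ^ 2 + (m + 1) ^ 2), 2 * m + 1]) fun i j => ?_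
  fin_cases i <;> fin_cases j <;>
    simp [hyperbolicMatrix] <;> ring

section Representation

variable {k : ℕ}

/-- The slope of the attracting direction of a letter. -/
def attractingSlope (x : Fin k × Bool) : ℤ :=
  2 * (x.1 : ℕ) + if x.2 then 0 else 1

theorem attractingSlope_injective : Function.Injective (attractingSlope (k := k)) := by
  rintro ⟨i, b⟩ ⟨j, c⟩ h
  have : (i : ℕ) = j ∧ b = c := by
    cases b <;> cases c <;> simp [attractingSlope] at h ⊢ <;> omega
  ext
  · exact this.1
  · rw [this.2]

/-- A vector spanning the image of the leading matrix of a letter. -/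
def letterVec (x : Fin k × Bool) : Fin 2 → ℤ :=
  ![1, attractingSlope x]

/-- A covector with the same kernel as the leading matrix of a letter. -/
def letterCovec (x : Fin k × Bool) : Fin 2 → ℤ :=
  (if x.2 then 1 else -1 : ℤ) • ![attractingSlope (x.1, !x.2), -1]

theorem letterCovec_dotProduct_letterVec_ne_zero {x y : Fin k × Bool} (h : x.1 = y.1 → x.2 = y.2) :
    letterCovec x ⬝ᵥ letterVec y ≠ 0 := by
  have hne : attractingSlope (x.1, !x.2) ≠ attractingSlope y := by
    intro he
    have hxy := attractingSlope_injective he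
    have h1 : x.1 = y.1 := by rw [← hxy]
    have h2 : (!x.2) = y.2 := by rw [← hxy]
    rw [← h h1] at h2
    simp at h2
  have hs : (if x.2 then 1 else -1 : ℤ) ≠ 0 := by split <;> simp
  rw [letterCovec, smul_dotProduct, smul_eq_mul]
  refine mul_ne_zero hs ?_
  simp only [letterVec, dotProduct, Fin.sum_univ_two, cons_val_zero, cons_val_one]
  intro h0
  exact hne (by linarith)

/-- The representation of a free group sending the generators to hyperbolic matrices with distinct
attracting and repelling directions. -/
noncomputable def schottkyRep (k : ℕ) :
    FreeGroup (Fin k) →* Matrix.SpecialLinearGroup (Fin 2) ℤ[X] :=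
  FreeGroup.lift fun i => hyperbolicMatrix (2 * (i : ℕ))

/-- The trace of the image of a group element under `schottkyRep`. -/
noncomputable def schottkyTrace (g : FreeGroup (Fin k)) : ℤ[X] :=
  (schottkyRep k g : Matrix (Fin 2) (Fin 2) ℤ[X]).trace

theorem hasLeadingMatrix_letter (x : Fin k × Bool) :
    HasLeadingMatrix 1 (schottkyRep k (FreeGroup.mk [x]))
      (vecMulVec (letterVec x) (letterCovec x)) := by
  obtain ⟨i, b⟩ := x
  cases b
  · convert hasLeadingMatrix_hyperbolicMatrix_inv (2 * (i : ℕ)) using 1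
    · simp [schottkyRep]
    · simp [letterVec, letterCovec, attractingSlope]
  · convert hasLeadingMatrix_hyperbolicMatrix (2 * (i : ℕ)) using 1
    · simp [schottkyRep]
    · simp [letterVec, letterCovec, attractingSlope]

theorem hasLeadingMatrix_word (L : List (Fin k × Bool)) :
    HasLeadingMatrix L.length (schottkyRep k (FreeGroup.mk L))
      (L.map fun x => vecMulVec (letterVec x) (letterCovec x)).prod := by
  induction L with
  | nil =>
    rw [← FreeGroup.one_eq_mk, map_one]
    exact HasLeadingMatrix.one
  | cons x L ih =>
    have h : FreeGroup.mk (x :: L) = FreeGroup.mk [x] * FreeGroup.mk L := by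
      rw [FreeGroup.mul_mk, List.singleton_append]
    rw [h, map_mul, List.length_cons, add_comm, List.map_cons, List.prod_cons]
    exact (hasLeadingMatrix_letter x).mul ih

theorem exists_prod_letter_eq_smul (x : Fin k × Bool) (L : List (Fin k × Bool))
    (h : FreeGroup.IsReduced (x :: L)) :
    ∃ c : ℤ, c ≠ 0 ∧ ((x :: L).map fun x => vecMulVec (letterVec x) (letterCovec x)).prod =
      c • vecMulVec (letterVec x) (letterCovec ((x :: L).getLast (List.cons_ne_nil _ _))) := by
  induction L generalizing x with
  | nil => exact ⟨1, one_ne_zero, by simp⟩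
  | cons y L ih =>
    obtain ⟨hxy, hL⟩ := List.isChain_cons_cons.1 h
    obtain ⟨c, hc, he⟩ := ih y hL
    refine ⟨c * (letterCovec x ⬝ᵥ letterVec y),
      mul_ne_zero hc (letterCovec_dotProduct_letterVec_ne_zero hxy), ?_⟩
    rw [List.map_cons, List.prod_cons, he, mul_smul_comm, vecMulVec_mul_vecMulVec,
      List.getLast_cons_cons, mul_smul, vecMulVec_smul]

theorem natDegree_schottkyTrace_mk {L : List (Fin k × Bool)}
    (h : FreeGroup.IsCyclicallyReduced L) :
    (schottkyTrace (FreeGroup.mk L)).natDegree = L.length := by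
  have hlead := hasLeadingMatrix_word L
  cases L with
  | nil => exact Nat.le_zero.1 hlead.natDegree_trace_le
  | cons x L =>
    refine le_antisymm hlead.natDegree_trace_le (le_natDegree_of_ne_zero ?_)
    obtain ⟨hred, hcyc⟩ := h
    obtain ⟨c, hc, he⟩ := exists_prod_letter_eq_smul x L hred
    rw [schottkyTrace, hlead.coeff_trace, he, trace_smul, trace_vecMulVec, smul_eq_mul,
      dotProduct_comm]
    refine mul_ne_zero hc (letterCovec_dotProduct_letterVec_ne_zero ?_)
    exact hcyc _ (List.getLast_mem_getLast? _) _ rfl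

theorem natDegree_schottkyTrace_le_norm (g : FreeGroup (Fin k)) :
    (schottkyTrace g).natDegree ≤ g.norm := by
  have h := (hasLeadingMatrix_word g.toWord).natDegree_trace_le
  rwa [FreeGroup.mk_toWord] at h

theorem schottkyTrace_mul_comm (g h : FreeGroup (Fin k)) :
    schottkyTrace (g * h) = schottkyTrace (h * g) := by
  simp only [schottkyTrace, map_mul, Matrix.SpecialLinearGroup.coe_mul]
  exact Matrix.trace_mul_comm _ _

theorem schottkyTrace_conj (g x : FreeGroup (Fin k)) :
    schottkyTrace (x * g * x⁻¹) = schottkyTrace g := by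
  rw [schottkyTrace_mul_comm, inv_mul_cancel_left]

theorem cyclLen_eq_natDegree (g : FreeGroup (Fin k)) :
    cyclLen g = (schottkyTrace g).natDegree := by
  refine IsLeast.csInf_eq ⟨?_, ?_⟩
  · set L := FreeGroup.reduceCyclically g.toWord
    have hred : FreeGroup.IsCyclicallyReduced L :=
      FreeGroup.reduceCyclically.isCyclicallyReduced FreeGroup.isReduced_toWord
    obtain ⟨c, hc⟩ : ∃ c, c * FreeGroup.mk L * c⁻¹ = g := by
      refine ⟨FreeGroup.mk (FreeGroup.reduceCyclically.conjugator g.toWord), ?_⟩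
      rw [FreeGroup.inv_mk, FreeGroup.mul_mk, FreeGroup.mul_mk,
        FreeGroup.reduceCyclically.conj_conjugator_reduceCyclically, FreeGroup.mk_toWord]
    have hg : c⁻¹ * g * c⁻¹⁻¹ = FreeGroup.mk L := by
      rw [← hc]
      group
    refine ⟨c⁻¹, ?_⟩
    rw [← schottkyTrace_conj g c⁻¹, hg, natDegree_schottkyTrace_mk hred, FreeGroup.norm,
      FreeGroup.toWord_mk, hred.isReduced.reduce_eq]
  · rintro n ⟨x, rfl⟩
    rw [← schottkyTrace_conj g x]
    exact natDegree_schottkyTrace_le_norm _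

theorem cyclLen_one : cyclLen (1 : FreeGroup (Fin k)) = 0 := by
  rw [cyclLen_eq_natDegree]
  exact Nat.le_zero.1 ((natDegree_schottkyTrace_le_norm 1).trans FreeGroup.norm_one.le)

theorem cyclLen_pos {g : FreeGroup (Fin k)} (hg : g ≠ 1) : 0 < cyclLen g := by
  have hne : {n : ℕ | ∃ x : FreeGroup (Fin k), FreeGroup.norm (x * g * x⁻¹) = n}.Nonempty :=
    ⟨_, 1, rfl⟩
  obtain ⟨x, hx⟩ := Nat.sInf_mem hne
  refine Nat.pos_of_ne_zero fun h0 => hg ?_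
  rw [cyclLen] at h0
  rwa [h0, FreeGroup.norm_eq_zero, conj_eq_one_iff] at hx

theorem cyclLen_conj (g x : FreeGroup (Fin k)) : cyclLen (x * g * x⁻¹) = cyclLen g := by
  rw [cyclLen_eq_natDegree, cyclLen_eq_natDegree, schottkyTrace_conj]

theorem Matrix.mul_self_fin_two {R : Type*} [CommRing R] (M : Matrix (Fin 2) (Fin 2) R) :
    M * M = M.trace • M - M.det • 1 := by
  ext i j
  fin_cases i <;> fin_cases j <;> simp [mul_apply, trace_fin_two, det_fin_two] <;> ring

theorem schottkyTrace_pow_add_two_mul (g h : FreeGroup (Fin k)) (n : ℕ) :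
    schottkyTrace (g ^ (n + 2) * h) =
      schottkyTrace g * schottkyTrace (g ^ (n + 1) * h) - schottkyTrace (g ^ n * h) := by
  have hsq : (schottkyRep k g : Matrix (Fin 2) (Fin 2) ℤ[X]) * schottkyRep k g =
      schottkyTrace g • (schottkyRep k g : Matrix (Fin 2) (Fin 2) ℤ[X]) - 1 := by
    rw [Matrix.mul_self_fin_two, (schottkyRep k g).det_coe, one_smul, schottkyTrace]
  simp only [schottkyTrace, map_mul, map_pow, Matrix.SpecialLinearGroup.coe_mul,
    Matrix.SpecialLinearGroup.coe_pow, pow_succ, mul_assoc] at hsq ⊢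
  rw [← mul_assoc (schottkyRep k g : Matrix (Fin 2) (Fin 2) ℤ[X]) (schottkyRep k g), hsq]
  simp [sub_mul, mul_sub, trace_sub, trace_smul]

/-- Degrees of a sequence satisfying `u (n + 2) = t * u (n + 1) - u n` grow linearly, as long as
there is no cancellation in the first step. -/
theorem natDegree_of_linear_recurrence {t : ℤ[X]} {u : ℕ → ℤ[X]}
    (hu : ∀ n, u (n + 2) = t * u (n + 1) - u n) (ht : 0 < t.natDegree)
    (h1 : 0 < (u 1).natDegree) (h0 : (u 0).natDegree < t.natDegree + (u 1).natDegree) (n : ℕ) :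
    (u (n + 1)).natDegree = n * t.natDegree + (u 1).natDegree := by
  suffices h : (u (n + 1)).natDegree = n * t.natDegree + (u 1).natDegree ∧
      (u n).natDegree < t.natDegree + (u (n + 1)).natDegree from h.1
  induction n with
  | zero => exact ⟨by simp, h0⟩
  | succ n ih =>
    obtain ⟨ih1, ih2⟩ := ih
    have hpos : 0 < (u (n + 1)).natDegree := by omega
    have hmul : (t * u (n + 1)).natDegree = t.natDegree + (u (n + 1)).natDegree :=
      natDegree_mul (ne_zero_of_natDegree_gt ht) (ne_zero_of_natDegree_gt hpos)
    have hstep : (u (n + 2)).natDegree = t.natDegree + (u (n + 1)).natDegree := by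
      rw [hu, natDegree_sub_eq_left_of_natDegree_lt (by omega), hmul]
    refine ⟨?_, ?_⟩
    · rw [hstep, ih1]
      ring
    · rw [hstep]
      omega

theorem cyclLen_pow_succ {g : FreeGroup (Fin k)} (hg : g ≠ 1) (n : ℕ) :
    cyclLen (g ^ (n + 1)) = (n + 1) * cyclLen g := by
  have hpos := cyclLen_pos hg
  rw [cyclLen_eq_natDegree] at hpos
  have h := natDegree_of_linear_recurrence (u := fun n => schottkyTrace (g ^ n))
    (fun n => by simpa using schottkyTrace_pow_add_two_mul g 1 n) hpos (by simpa using hpos)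
    (by
      have h1 : (schottkyTrace (1 : FreeGroup (Fin k))).natDegree = 0 := by
        rw [← cyclLen_eq_natDegree, cyclLen_one]
      rw [pow_zero, h1]
      omega) n
  rw [cyclLen_eq_natDegree, cyclLen_eq_natDegree, h]
  simp only [pow_one]
  ring

theorem cyclLen_pow_mul_pow {g h : FreeGroup (Fin k)} (hgh : cyclLen g = cyclLen h) (hg : g ≠ 1)
    (hne : g * h ≠ 1) (p q : ℕ) :
    cyclLen (g ^ (p + 1) * h ^ (q + 1)) = (p + q) * cyclLen g + cyclLen (g * h) := by
  have hpos := cyclLen_pos hg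
  have hpos' := cyclLen_pos hne
  have hh : h ≠ 1 := by
    rintro rfl
    rw [cyclLen_one] at hgh
    omega
  have hq : (schottkyTrace (g * h ^ (q + 1))).natDegree = q * cyclLen g + cyclLen (g * h) := by
    have := natDegree_of_linear_recurrence (t := schottkyTrace h)
      (u := fun n => schottkyTrace (g * h ^ n))
      (fun n => by
        simp only [schottkyTrace_mul_comm g]
        exact schottkyTrace_pow_add_two_mul h g n)
      (by rwa [← cyclLen_eq_natDegree, ← hgh])
      (by simpa [← cyclLen_eq_natDegree] using hpos')
      (by simp [← cyclLen_eq_natDegree]; omega) q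
    simpa only [← cyclLen_eq_natDegree, pow_one, ← hgh] using this
  have hp := natDegree_of_linear_recurrence (t := schottkyTrace g)
      (u := fun n => schottkyTrace (g ^ n * h ^ (q + 1)))
      (fun n => schottkyTrace_pow_add_two_mul g _ n)
      (by rwa [← cyclLen_eq_natDegree])
      (by rw [pow_one, hq]; omega)
      (by
        rw [pow_one, hq, pow_zero, one_mul, ← cyclLen_eq_natDegree, ← cyclLen_eq_natDegree,
          cyclLen_pow_succ hh, ← hgh]
        linarith) p
  rw [cyclLen_eq_natDegree, hp, pow_one, hq, ← cyclLen_eq_natDegree]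
  ring

/-- For translation equivalent `g` and `h`, the translation equivalence class of `g ^ p * h ^ q`
with `p, q > 0` depends only on `p + q`. -/
theorem TransEquiv.pow_mul_pow {g h : FreeGroup (Fin k)} (hgh : TransEquiv g h) (hg : g ≠ 1)
    (hne : g * h ≠ 1) {p q p' q' : ℕ} (hpq : p + q = p' + q') :
    TransEquiv (g ^ (p + 1) * h ^ (q + 1)) (g ^ (p' + 1) * h ^ (q' + 1)) := by
  intro φ
  have hφg : φ g ≠ 1 := by simpa using hg
  have hφne : φ g * φ h ≠ 1 := by
    rw [← map_mul]
    exact (map_ne_one_iff φ φ.injective).2 hne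
  simp only [map_mul, map_pow]
  rw [cyclLen_pow_mul_pow (hgh φ) hφg hφne, cyclLen_pow_mul_pow (hgh φ) hφg hφne, hpq]

theorem transEquiv_conj (g x : FreeGroup (Fin k)) : TransEquiv g (x * g * x⁻¹) := by
  intro φ
  simp only [map_mul, map_inv, cyclLen_conj]

end Representation

section Modular

variable {R : Type*} [CommRing R]

theorem trace_eq_of_isConj {A B : Matrix.SpecialLinearGroup (Fin 2) R} (h : IsConj A B) :
    (A : Matrix (Fin 2) (Fin 2) R).trace = (B : Matrix (Fin 2) (Fin 2) R).trace := by
  obtain ⟨c, rfl⟩ := isConj_iff.1 h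
  rw [Matrix.SpecialLinearGroup.coe_mul, trace_mul_comm, ← Matrix.SpecialLinearGroup.coe_mul,
    inv_mul_cancel_left]

theorem trace_specialLinearGroup_inv (A : Matrix.SpecialLinearGroup (Fin 2) R) :
    ((A⁻¹ : Matrix.SpecialLinearGroup (Fin 2) R) : Matrix (Fin 2) (Fin 2) R).trace =
      (A : Matrix (Fin 2) (Fin 2) R).trace := by
  simp [Matrix.SpecialLinearGroup.coe_inv, adjugate_fin_two, trace_fin_two, add_comm]

theorem trace_T_pow_mul_S_conj (p q : ℕ) :
    ((ModularGroup.T ^ p * (ModularGroup.S * ModularGroup.T * ModularGroup.S⁻¹) ^ q :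
      Matrix.SpecialLinearGroup (Fin 2) ℤ) : Matrix (Fin 2) (Fin 2) ℤ).trace = 2 - p * q := by
  rw [conj_pow, ← zpow_natCast, ← zpow_natCast]
  simp only [Matrix.SpecialLinearGroup.coe_mul, Matrix.SpecialLinearGroup.coe_inv,
    ModularGroup.coe_T_zpow, ModularGroup.coe_S, adjugate_fin_two_of]
  simp [trace_fin_two]
  ring

end Modular

theorem arbitrarily_many_translation_equivalent_elements {k : ℕ} (hk : 2 ≤ k)
    (M : ℕ) (hM : 1 ≤ M) :
    ∃ g : Fin M → FreeGroup (Fin k),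
      (∀ i j : Fin M, TransEquiv (g i) (g j)) ∧
      (∀ i j : Fin M, i ≠ j → ¬ IsConj (g i) (g j) ∧ ¬ IsConj (g i) (g j)⁻¹) := by
  let a : FreeGroup (Fin k) := FreeGroup.of ⟨0, by omega⟩
  let b : FreeGroup (Fin k) := FreeGroup.of ⟨1, by omega⟩
  let w : ℕ → ℕ → FreeGroup (Fin k) := fun p q => a ^ p * (b * a * b⁻¹) ^ q
  let ψ : FreeGroup (Fin k) →* Matrix.SpecialLinearGroup (Fin 2) ℤ :=
    FreeGroup.lift fun i => if (i : ℕ) = 0 then ModularGroup.T else ModularGroup.S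
  have htrace (p q : ℕ) : (ψ (w p q) : Matrix (Fin 2) (Fin 2) ℤ).trace = 2 - p * q := by
    rw [← trace_T_pow_mul_S_conj]
    simp [ψ, w, a, b]
  have ha : a ≠ 1 := FreeGroup.of_ne_one _
  have hne : a * (b * a * b⁻¹) ≠ 1 := by
    intro h
    have h11 := htrace 1 1
    simp [w, h] at h11
  have hinj (i j : Fin M)
      (h : (ψ (w (i + 1) (2 * M - i + 1)) : Matrix (Fin 2) (Fin 2) ℤ).trace =
        (ψ (w (j + 1) (2 * M - j + 1)) : Matrix (Fin 2) (Fin 2) ℤ).trace) : i = j := by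
    have hi := i.isLt
    have hj := j.isLt
    rw [htrace, htrace] at h
    push_cast [Nat.cast_sub (show (i : ℕ) ≤ 2 * M by omega),
      Nat.cast_sub (show (j : ℕ) ≤ 2 * M by omega)] at h
    have hprod : ((i : ℤ) - j) * (2 * M - i - j) = 0 := by linear_combination -h
    rcases mul_eq_zero.1 hprod with h0 | h0
    · ext
      omega
    · omega
  refine ⟨fun i => w (i + 1) (2 * M - i + 1), fun i j => ?_,
    fun i j hij => ⟨fun h => ?_, fun h => ?_⟩⟩
  · exact (transEquiv_conj a b).pow_mul_pow ha hne (by omega)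
  · exact hij (hinj i j (trace_eq_of_isConj (ψ.map_isConj h)))
  · refine hij (hinj i j ?_)
    rw [trace_eq_of_isConj (ψ.map_isConj h), map_inv, trace_specialLinearGroup_inv]
end

section
/- Let τ be the automorphism of the rank-two free group FreeGroup (Fin 2) sending each generator to its inverse. Then the image of τ in the outer automorphism group is central: for every automorphism φ of FreeGroup (Fin 2) and every w ∈ FreeGroup (Fin 2), the element φ (τ w) is conjugate to τ (φ w). Equivalently, for every cyclic word w and every automorphism φ of FreeGroup (Fin 2), (φ w)^R = φ (w^R) as cyclic words. -/
namespace Sanov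

open Matrix

/-- The upper unipotent generator of the Sanov subgroup. -/
def upper : SpecialLinearGroup (Fin 2) ℤ := ⟨!![1, 2; 0, 1], by simp [det_fin_two]⟩

/-- The lower unipotent generator of the Sanov subgroup. -/
def lower : SpecialLinearGroup (Fin 2) ℤ := ⟨!![1, 0; 2, 1], by simp [det_fin_two]⟩

/-- The Sanov representation of the free group of rank two. -/
def rep : FreeGroup (Fin 2) →* SpecialLinearGroup (Fin 2) ℤ := FreeGroup.lift ![upper, lower]

/-- The Sanov representation, with values in integer matrices. -/
def mrep : FreeGroup (Fin 2) →* Matrix (Fin 2) (Fin 2) ℤ :=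
  (SpecialLinearGroup.toGL.comp rep |> (Units.coeHom _).comp)

theorem mrep_apply (w : FreeGroup (Fin 2)) : mrep w = (rep w : Matrix (Fin 2) (Fin 2) ℤ) := rfl

theorem mrep_of_zero : mrep (FreeGroup.of 0) = !![1, 2; 0, 1] := by
  simp [mrep_apply, rep, upper]

theorem mrep_of_one : mrep (FreeGroup.of 1) = !![1, 0; 2, 1] := by
  simp [mrep_apply, rep, lower]

theorem coe_upper_inv : (upper⁻¹).1 = !![1, -2; 0, 1] := by
  exact (Matrix.SpecialLinearGroup.coe_inv upper).trans (by simp [upper, adjugate_fin_two])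

theorem coe_lower_inv : (lower⁻¹).1 = !![1, 0; -2, 1] := by
  exact (Matrix.SpecialLinearGroup.coe_inv lower).trans (by simp [lower, adjugate_fin_two])

theorem mrep_of_zero_inv : mrep (FreeGroup.of 0)⁻¹ = !![1, -2; 0, 1] := by
  simpa [mrep_apply, rep] using coe_upper_inv

theorem mrep_of_one_inv : mrep (FreeGroup.of 1)⁻¹ = !![1, 0; -2, 1] := by
  simpa [mrep_apply, rep] using coe_lower_inv

theorem det_mrep (w : FreeGroup (Fin 2)) :
    mrep w 0 0 * mrep w 1 1 - mrep w 0 1 * mrep w 1 0 = 1 := by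
  rw [← det_fin_two]
  exact (rep w).2

theorem rep_injective : Function.Injective rep := by
  let X : Fin 2 → Set (SpecialLinearGroup (Fin 2) ℤ) :=
    ![{g | g.1 1 0 * g.1 1 0 ≤ g.1 0 0 * g.1 1 0},
      {g | 0 ≤ g.1 0 0 * g.1 1 0 ∧ g.1 0 0 * g.1 1 0 < g.1 1 0 * g.1 1 0}]
  let Y : Fin 2 → Set (SpecialLinearGroup (Fin 2) ℤ) :=
    ![{g | g.1 0 0 * g.1 1 0 < -(g.1 1 0 * g.1 1 0)},
      {g | -(g.1 1 0 * g.1 1 0) ≤ g.1 0 0 * g.1 1 0 ∧ g.1 0 0 * g.1 1 0 < 0}]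
  have hpos (g : SpecialLinearGroup (Fin 2) ℤ) :
      0 < g.1 0 0 * g.1 0 0 + g.1 1 0 * g.1 1 0 := by
    have h := g.2
    rw [det_fin_two] at h
    by_contra! hle
    have h0 : g.1 0 0 = 0 := by nlinarith [mul_self_nonneg (g.1 0 0), mul_self_nonneg (g.1 1 0)]
    have h1 : g.1 1 0 = 0 := by nlinarith [mul_self_nonneg (g.1 0 0), mul_self_nonneg (g.1 1 0)]
    simp [h0, h1] at h
  apply FreeGroup.injective_lift_of_ping_pong _ X Y
  · intro i
    fin_cases i
    · exact ⟨1, by simp [X]⟩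
    · exact ⟨⟨!![0, -1; 1, 0], by simp [det_fin_two]⟩, by change _ ∧ _; simp⟩
  · intro i j hij
    rw [Function.onFun, Set.disjoint_left]
    intro g hi hj
    fin_cases i <;> fin_cases j <;> simp [X] at * <;> linarith
  · intro i j hij
    rw [Function.onFun, Set.disjoint_left]
    intro g hi hj
    fin_cases i <;> fin_cases j <;> simp [Y] at * <;> linarith
  · intro i j
    rw [Set.disjoint_left]
    intro g hi hj
    have := mul_self_nonneg (g.1 1 0)
    fin_cases i <;> fin_cases j <;> simp [X, Y] at * <;> linarith
  · rintro i _ ⟨g, hg, rfl⟩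
    have hg0 := hpos g
    fin_cases i
    · replace hg : ¬ g.1 0 0 * g.1 1 0 < -(g.1 1 0 * g.1 1 0) := hg
      change (upper.1 * g.1) 1 0 * (upper.1 * g.1) 1 0 ≤ (upper.1 * g.1) 0 0 * (upper.1 * g.1) 1 0
      simp [upper, mul_apply]
      nlinarith
    · replace hg : ¬ (_ ≤ _ ∧ _ < _) := hg
      change 0 ≤ (lower.1 * g.1) 0 0 * (lower.1 * g.1) 1 0 ∧
        (lower.1 * g.1) 0 0 * (lower.1 * g.1) 1 0 < (lower.1 * g.1) 1 0 * (lower.1 * g.1) 1 0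
      simp [lower, mul_apply]
      generalize g.1 0 0 = x at *
      generalize g.1 1 0 = y at *
      by_cases h : -(y * y) ≤ x * y
      · have hxy : 0 ≤ x * y := by by_contra! h'; exact hg ⟨h, h'⟩
        constructor <;> nlinarith
      · constructor <;> nlinarith [mul_self_nonneg (x + y), mul_self_nonneg x]
  · rintro i _ ⟨g, hg, rfl⟩
    have hg0 := hpos g
    fin_cases i
    · replace hg : ¬ g.1 1 0 * g.1 1 0 ≤ g.1 0 0 * g.1 1 0 := hg
      change ((upper⁻¹).1 * g.1) 0 0 * ((upper⁻¹).1 * g.1) 1 0 <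
        -(((upper⁻¹).1 * g.1) 1 0 * ((upper⁻¹).1 * g.1) 1 0)
      rw [coe_upper_inv]
      simp [mul_apply]
      nlinarith
    · replace hg : ¬ (_ ≤ _ ∧ _ < _) := hg
      change -(((lower⁻¹).1 * g.1) 1 0 * ((lower⁻¹).1 * g.1) 1 0) ≤
        ((lower⁻¹).1 * g.1) 0 0 * ((lower⁻¹).1 * g.1) 1 0 ∧
        ((lower⁻¹).1 * g.1) 0 0 * ((lower⁻¹).1 * g.1) 1 0 < 0
      rw [coe_lower_inv]
      simp [mul_apply]
      generalize g.1 0 0 = x at *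
      generalize g.1 1 0 = y at *
      by_cases h : 0 ≤ x * y
      · have hxy : y * y ≤ x * y := by by_contra! h'; exact hg ⟨h, h'⟩
        constructor <;> nlinarith [mul_self_nonneg (x - y), mul_self_nonneg x]
      · constructor <;> nlinarith [mul_self_nonneg (x - y), mul_self_nonneg x]

theorem mrep_injective : Function.Injective mrep := fun _ _ h =>
  rep_injective (Subtype.ext h)

theorem mrep_of_zero_zpow (n : ℤ) : mrep (FreeGroup.of 0 ^ n) = !![1, 2 * n; 0, 1] := by
  induction n with
  | zero => simp [one_fin_two]
  | succ n ih =>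
    rw [_root_.zpow_add_one, map_mul, ih, mrep_of_zero]
    simp
    ring
  | pred n ih =>
    rw [_root_.zpow_sub_one, map_mul, ih, mrep_of_zero_inv]
    simp
    ring

/-- The exponent sum of the first generator. -/
def expSum : FreeGroup (Fin 2) →* Multiplicative ℤ :=
  FreeGroup.lift ![Multiplicative.ofAdd 1, 1]

/-- Matrices in the Sanov subgroup are congruent to the identity modulo two, with diagonal entries
congruent to one modulo four, and their upper right entry detects the parity of `expSum`. -/
theorem mrep_congr (w : FreeGroup (Fin 2)) :
    ∃ i j k l : ℤ, mrep w = !![1 + 4 * i, 2 * j; 2 * k, 1 + 4 * l] ∧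
      2 ∣ j - (expSum w).toAdd := by
  induction w using FreeGroup.induction_on with
  | C1 => exact ⟨0, 0, 0, 0, by simp [one_fin_two], by simp⟩
  | of x =>
    fin_cases x
    · exact ⟨0, 1, 0, 0, by simpa using mrep_of_zero, by simp [expSum]⟩
    · exact ⟨0, 0, 1, 0, by simpa using mrep_of_one, by simp [expSum]⟩
  | inv_of x _ =>
    fin_cases x
    · exact ⟨0, -1, 0, 0, by simpa using mrep_of_zero_inv, by simp [expSum]⟩
    · exact ⟨0, 0, -1, 0, by simpa using mrep_of_one_inv, by simp [expSum]⟩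
  | mul x y hx hy =>
    obtain ⟨i, j, k, l, hx, m, hm⟩ := hx
    obtain ⟨i', j', k', l', hy, m', hm'⟩ := hy
    refine ⟨i + i' + 4 * i * i' + j * k', j + j' + 4 * i * j' + 4 * j * l',
      k + k' + 4 * k * i' + 4 * l * k', l + l' + 4 * l * l' + k * j', ?_,
      m + m' + 2 * i * j' + 2 * j * l', ?_⟩
    · rw [map_mul, hx, hy]
      simp
      refine ⟨⟨?_, ?_⟩, ?_, ?_⟩ <;> ring
    · rw [map_mul, toAdd_mul]
      linear_combination hm + hm'

/-- Euclidean reduction of the first column under the Sanov subgroup. -/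
theorem exists_reduce_column (E : Matrix (Fin 2) (Fin 2) ℤ) :
    ∃ g, (mrep g * E) 0 0 = 0 ∨ (mrep g * E) 1 0 = 0 ∨ (mrep g * E) 0 0 = (mrep g * E) 1 0 := by
  induction hn : (E 0 0).natAbs + (E 1 0).natAbs using Nat.strong_induction_on generalizing E with
  | _ n ih =>
  have step (s : FreeGroup (Fin 2))
      (hs : ((mrep s * E) 0 0).natAbs + ((mrep s * E) 1 0).natAbs < n) :
      ∃ g, (mrep g * E) 0 0 = 0 ∨ (mrep g * E) 1 0 = 0 ∨
        (mrep g * E) 0 0 = (mrep g * E) 1 0 := by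
    obtain ⟨g, hg⟩ := ih _ hs (mrep s * E) rfl
    exact ⟨g * s, by simpa only [map_mul, Matrix.mul_assoc] using hg⟩
  by_cases h0 : E 0 0 = 0
  · exact ⟨1, by simp [h0]⟩
  by_cases h1 : E 1 0 = 0
  · exact ⟨1, by simp [h1]⟩
  by_cases h2 : E 0 0 = E 1 0
  · exact ⟨1, by simp [h2]⟩
  by_cases h3 : E 0 0 = -E 1 0
  · refine ⟨FreeGroup.of 1, Or.inr (Or.inr ?_)⟩
    rw [mrep_of_one]
    simp [mul_apply]
    omega
  by_cases hlt : (E 1 0).natAbs < (E 0 0).natAbs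
  · by_cases hs : 0 < E 0 0 ↔ 0 < E 1 0
    · apply step (FreeGroup.of 0)⁻¹
      rw [mrep_of_zero_inv]
      simp [mul_apply]
      omega
    · apply step (FreeGroup.of 0)
      rw [mrep_of_zero]
      simp [mul_apply]
      omega
  · by_cases hs : 0 < E 0 0 ↔ 0 < E 1 0
    · apply step (FreeGroup.of 1)⁻¹
      rw [mrep_of_one_inv]
      simp [mul_apply]
      omega
    · apply step (FreeGroup.of 1)
      rw [mrep_of_one]
      simp [mul_apply]
      omega

/-- An endomorphism that preserves `expSum` and is intertwined with the identity by a nonzero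
matrix is inner. -/
theorem exists_conj_of_intertwine (ψ : FreeGroup (Fin 2) →* FreeGroup (Fin 2))
    (hψ : ∀ w, expSum (ψ w) = expSum w) (E : Matrix (Fin 2) (Fin 2) ℤ) (hE : E ≠ 0)
    (hint : ∀ w, E * mrep w = mrep (ψ w) * E) :
    ∃ g, ∀ w, ψ w = g * w * g⁻¹ := by
  obtain ⟨g, hg⟩ := exists_reduce_column E
  set F := mrep g * E with hF
  let χ : FreeGroup (Fin 2) →* FreeGroup (Fin 2) := (MulAut.conj g).toMonoidHom.comp ψ
  have hχ (w) : χ w = g * ψ w * g⁻¹ := rfl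
  have hχe (w) : expSum (χ w) = expSum w := by
    rw [hχ, map_mul, map_mul, map_inv, mul_inv_cancel_comm, hψ]
  have hEF : E = mrep g⁻¹ * F := by
    rw [hF, ← Matrix.mul_assoc, ← map_mul, inv_mul_cancel, map_one, Matrix.one_mul]
  have hFint (w) : F * mrep w = mrep (χ w) * F := by
    rw [hF, hχ, Matrix.mul_assoc, hint, ← Matrix.mul_assoc, ← Matrix.mul_assoc, ← map_mul,
      ← map_mul, inv_mul_cancel_right]
  obtain ⟨i, j, k, l, hA, m, hm⟩ := mrep_congr (χ (FreeGroup.of 0))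
  obtain ⟨i', j', k', l', hB, -⟩ := mrep_congr (χ (FreeGroup.of 1))
  have dA := det_mrep (χ (FreeGroup.of 0))
  have eA := hFint (FreeGroup.of 0)
  have eB := hFint (FreeGroup.of 1)
  have hsum : (expSum (χ (FreeGroup.of 0))).toAdd = 1 := by
    rw [hχe]; simp [expSum]
  rw [hsum] at hm
  rw [hA] at eA dA
  rw [mrep_of_zero] at eA
  rw [hB, mrep_of_one] at eB
  have hFne : ¬ (F 0 0 = 0 ∧ F 1 0 = 0 ∧ F 0 1 = 0 ∧ F 1 1 = 0) := by
    rintro ⟨h1, h2, h3, h4⟩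
    apply hE
    have : F = 0 := by
      ext a b
      fin_cases a <;> fin_cases b <;> assumption
    rw [hEF, this, Matrix.mul_zero]
  rw [← Matrix.ext_iff] at eA eB
  have a00 := eA 0 0
  have a01 := eA 0 1
  have a10 := eA 1 0
  have a11 := eA 1 1
  have b00 := eB 0 0
  have b01 := eB 0 1
  have b10 := eB 1 0
  have b11 := eB 1 1
  simp only [mul_apply, Fin.sum_univ_two, of_apply, cons_val', cons_val_zero, cons_val_one,
    cons_val_fin_one] at dA a00 a01 a10 a11 b00 b01 b10 b11
  generalize F 0 0 = p at *
  generalize F 0 1 = q at *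
  generalize F 1 0 = r at *
  generalize F 1 1 = s at *
  have hcol : ¬ (p = 0 ∧ r = 0) := by
    rintro ⟨rfl, rfl⟩
    apply hFne
    refine ⟨rfl, rfl, ?_, ?_⟩ <;> linarith
  have hr : r = 0 := by
    rcases hg with h | h | h
    · subst h
      have hr : r ≠ 0 := by simpa using hcol
      have : j = 0 := by
        have : j * r = 0 := by linarith
        simpa [hr] using this
      omega
    · exact h
    · subst h
      have hp : p ≠ 0 := by simpa using hcol
      have : 2 * i + j = 0 := by
        have : (2 * i + j) * p = 0 := by linarith
        simpa [hp] using this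
      omega
  subst hr
  have hp : p ≠ 0 := by simpa using hcol
  have hi : i = 0 := by
    have : i * p = 0 := by linarith
    simpa [hp] using this
  have hk : k = 0 := by
    have : k * p = 0 := by linarith
    simpa [hp] using this
  subst hi hk
  have hl : l = 0 := by linarith
  subst hl
  have hχa : χ (FreeGroup.of 0) = FreeGroup.of 0 := by
    have : χ (FreeGroup.of 0) = FreeGroup.of 0 ^ j := by
      apply mrep_injective
      rw [mrep_of_zero_zpow, hA]
      simp
    rw [this, map_zpow, toAdd_zpow] at hsum
    have hj : j = 1 := by simpa [expSum] using hsum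
    rw [this, hj, zpow_one]
  rw [hχa, mrep_of_zero] at hA
  have hj : j = 1 := by
    have := congrFun (congrFun hA 0) 1
    simp at this
    omega
  subst hj
  have hs : s = p := by linarith
  subst hs
  have hq : q = 2 * i' * s := by linarith
  subst hq
  have hk' : k' = 1 := by
    have : (k' - 1) * s = 0 := by linarith
    have := (mul_eq_zero.mp this).resolve_right hp
    omega
  subst hk'
  have hl' : l' = -i' := by
    have : (l' + i') * s = 0 := by linarith
    have := (mul_eq_zero.mp this).resolve_right hp
    omega
  subst hl'
  have hj' : j' = -4 * i' * i' := by
    have : (j' + 4 * i' * i') * s = 0 := by linarith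
    have := (mul_eq_zero.mp this).resolve_right hp
    linarith
  subst hj'
  have hχb : χ (FreeGroup.of 1) =
      FreeGroup.of 0 ^ i' * FreeGroup.of 1 * (FreeGroup.of 0 ^ i')⁻¹ := by
    apply mrep_injective
    rw [hB, ← _root_.zpow_neg, map_mul, map_mul, mrep_of_zero_zpow, mrep_of_zero_zpow, mrep_of_one]
    simp
    refine ⟨⟨?_, ?_⟩, ?_⟩ <;> ring
  have hχconj : χ = (MulAut.conj (FreeGroup.of 0 ^ i')).toMonoidHom := by
    ext x
    fin_cases x
    · exact hχa.trans (eq_mul_inv_of_mul_eq ((Commute.refl _).zpow_right i'))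
    · exact hχb
  refine ⟨g⁻¹ * FreeGroup.of 0 ^ i', fun w => ?_⟩
  have h1 : g * ψ w * g⁻¹ = FreeGroup.of 0 ^ i' * w * (FreeGroup.of 0 ^ i')⁻¹ := by
    rw [← hχ, hχconj]; rfl
  calc ψ w = g⁻¹ * (g * ψ w * g⁻¹) * g := by group
    _ = _ := by rw [h1]; group

/-- The commutator of two matrices of determinant one intertwines each of them with its inverse. -/
theorem commutator_intertwine (u v : FreeGroup (Fin 2)) :
    (mrep (u * v) - mrep (v * u)) * mrep u = mrep u⁻¹ * (mrep (u * v) - mrep (v * u)) ∧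
    (mrep (u * v) - mrep (v * u)) * mrep v = mrep v⁻¹ * (mrep (u * v) - mrep (v * u)) := by
  have key (x y : FreeGroup (Fin 2)) :
      (mrep (x * y) - mrep (y * x)) * mrep x = mrep x⁻¹ * (mrep (x * y) - mrep (y * x)) := by
    have hinv : mrep x⁻¹ = !![mrep x 1 1, -mrep x 0 1; -mrep x 1 0, mrep x 0 0] := by
      rw [mrep_apply, map_inv]
      exact (Matrix.SpecialLinearGroup.coe_inv (rep x)).trans (adjugate_fin_two _)
    rw [hinv, map_mul, map_mul]
    ext a b
    fin_cases a <;> fin_cases b <;> simp [mul_apply] <;> ring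
  refine ⟨key u v, ?_⟩
  rw [← neg_sub, Matrix.neg_mul, Matrix.mul_neg, key v u]

end Sanov

theorem tau_central_in_out_F2
    (τ : FreeGroup (Fin 2) ≃* FreeGroup (Fin 2))
    (hτ : ∀ i : Fin 2, τ (FreeGroup.of i) = (FreeGroup.of i)⁻¹) :
    ∀ (φ : FreeGroup (Fin 2) ≃* FreeGroup (Fin 2)) (w : FreeGroup (Fin 2)),
      IsConj (φ (τ w)) (τ (φ w)) := by
  intro φ w
  have hττ (w) : τ (τ w) = w := by
    have : τ.toMonoidHom.comp τ.toMonoidHom = MonoidHom.id _ := by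
      ext i
      simp [hτ]
    exact DFunLike.congr_fun this w
  have hinv (f : FreeGroup (Fin 2) →* Multiplicative ℤ) (w) : f (τ w) = (f w)⁻¹ := by
    have : f.comp τ.toMonoidHom = f⁻¹ := by
      ext i
      simp [hτ]
    exact DFunLike.congr_fun this w
  have intertwine {D : Matrix (Fin 2) (Fin 2) ℤ} {f : FreeGroup (Fin 2) →* FreeGroup (Fin 2)}
      (h : ∀ i, D * Sanov.mrep (f (.of i)) = Sanov.mrep (f (.of i))⁻¹ * D) (w) :
      D * Sanov.mrep (f w) = Sanov.mrep (f (τ w)) * D := by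
    induction w using FreeGroup.induction_on with
    | C1 => simp
    | of i => rw [h, hτ, map_inv f]
    | inv_of i _ =>
      have h1 : Sanov.mrep (f (.of i)) * Sanov.mrep (f (.of i))⁻¹ = 1 := by
        rw [← map_mul, mul_inv_cancel, map_one]
      rw [map_inv f, map_inv τ, hτ, inv_inv]
      calc D * Sanov.mrep (f (.of i))⁻¹
          = Sanov.mrep (f (.of i)) * (Sanov.mrep (f (.of i))⁻¹ * D) *
              Sanov.mrep (f (.of i))⁻¹ := by
            rw [← Matrix.mul_assoc, h1, Matrix.one_mul]
        _ = _ := by rw [← h, Matrix.mul_assoc, Matrix.mul_assoc, h1, Matrix.mul_one]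
    | mul x y hx hy =>
      rw [map_mul, map_mul, map_mul, map_mul, map_mul, ← Matrix.mul_assoc, hx, Matrix.mul_assoc,
        hy, Matrix.mul_assoc]
  let C : Matrix (Fin 2) (Fin 2) ℤ := !![1, 0; 0, -1]
  let u := φ (.of 0)
  let v := φ (.of 1)
  let D := Sanov.mrep (u * v) - Sanov.mrep (v * u)
  have hC (w) : C * Sanov.mrep w = Sanov.mrep (τ w) * C := by
    refine intertwine (f := MonoidHom.id _) (fun i => ?_) w
    fin_cases i
    · simp [C, Sanov.mrep_of_zero, Sanov.mrep_of_zero_inv]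
    · simp [C, Sanov.mrep_of_one, Sanov.mrep_of_one_inv]
  have hD (w) : D * Sanov.mrep (φ w) = Sanov.mrep (φ (τ w)) * D := by
    refine intertwine (f := φ.toMonoidHom) (fun i => ?_) w
    fin_cases i
    · exact (Sanov.commutator_intertwine u v).1
    · exact (Sanov.commutator_intertwine u v).2
  have hCC : C * C = 1 := by simp [C, Matrix.one_fin_two]
  have hDC : D * C ≠ 0 := by
    intro h0
    have hD0 : D = 0 := by
      rw [← Matrix.mul_one D, ← hCC, ← Matrix.mul_assoc, h0, Matrix.zero_mul]
    have h1 := Sanov.mrep_injective (sub_eq_zero.mp hD0)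
    rw [← map_mul, ← map_mul] at h1
    exact absurd (φ.injective h1) (by decide)
  obtain ⟨g, hg⟩ := Sanov.exists_conj_of_intertwine
    (φ.toMonoidHom.comp (τ.toMonoidHom.comp (φ.symm.toMonoidHom.comp τ.toMonoidHom)))
    (fun w => by
      have := hinv (Sanov.expSum.comp φ.toMonoidHom) (φ.symm (τ w))
      refine this.trans ?_
      simp [hinv])
    (D * C) hDC
    (fun w => by
      have := hD (φ.symm (τ w))
      rw [φ.apply_symm_apply] at this
      rw [Matrix.mul_assoc, hC, ← Matrix.mul_assoc, this, Matrix.mul_assoc]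
      rfl)
  have := hg (τ (φ w))
  simp only [MonoidHom.comp_apply, MulEquiv.toMonoidHom_eq_coe, MonoidHom.coe_coe, hττ,
    φ.symm_apply_apply] at this
  rw [this]
  exact (isConj_iff.mpr ⟨g, rfl⟩).symm
end
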